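/- arXiv:1304.3894 — 2 statements merged into one kernel-verified Lean document; each statement's English description precedes it below -/
import Mathlib

section
/- Let q(X_1,...,X_n) be a quadratic form of rank r over a field K, and suppose the hyperplane X_n = 0 is the tangent hyperplane to the quadric q = 0 at some nonsingular point of the quadric. Then the quadratic form q(X_1,...,X_{n-1},0) in n-1 variables has rank r - 2. -/
open MvPolynomial NumberField IsDedekindDomain

/-- Substitution `q(T·X)` for a matrix `T`. -/
noncomputable def substMat {K : Type*} [CommRing K] {n : ℕ}
    (T : Matrix (Fin n) (Fin n) K) (q : MvPolynomial (Fin n) K) : MvPolynomial (Fin n) K :=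
  MvPolynomial.aeval (fun i => ∑ j, MvPolynomial.C (T i j) * MvPolynomial.X j) q

/-- `q` is a function of the variables `X_0, …, X_{m-1}` alone. -/
def DependsOnlyOnFirst {K : Type*} [CommRing K] {n : ℕ} (m : ℕ)
    (q : MvPolynomial (Fin n) K) : Prop :=
  ∀ i ∈ q.vars, (i : ℕ) < m

/-- The rank of a quadratic form: the least `m` such that an invertible linear change of
variables makes it a function of the first `m` variables alone. -/
noncomputable def qRank {K : Type*} [Field K] {n : ℕ} (q : MvPolynomial (Fin n) K) : ℕ :=
  sInf {m | ∃ T : Matrix (Fin n) (Fin n) K, IsUnit T.det ∧ DependsOnlyOnFirst m (substMat T q)}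

/-- The polynomial `X_0X_1 + X_2X_3 + ⋯ + X_{2m-2}X_{2m-1}` (a sum of `m` hyperbolic planes). -/
noncomputable def hypSum (n m : ℕ) (K : Type*) [CommRing K] : MvPolynomial (Fin n) K :=
  ∑ i ∈ Finset.range m,
    if h : 2 * i + 1 < n then
      MvPolynomial.X (⟨2 * i, by omega⟩ : Fin n) * MvPolynomial.X (⟨2 * i + 1, h⟩ : Fin n)
    else 0

/-- A quadratic form in `n` variables splits off (at least) `m` hyperbolic planes: an invertible
change of variables puts it in the shape `X_0X_1 + ⋯ + X_{2m-2}X_{2m-1} + Q'(X_{2m},…,X_{n-1})`. -/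
def SplitsOffHyperbolics {K : Type*} [Field K] {n : ℕ} (m : ℕ)
    (Q : MvPolynomial (Fin n) K) : Prop :=
  2 * m ≤ n ∧ ∃ T : Matrix (Fin n) (Fin n) K, IsUnit T.det ∧
    ∃ Q' : MvPolynomial (Fin n) K, (∀ i ∈ Q'.vars, 2 * m ≤ (i : ℕ)) ∧
      substMat T Q = hypSum n m K + Q'

/-- The intersection of the two quadrics `Q₁ = Q₂ = 0` is nonsingular: the `2 × n` matrix of
partial derivatives has rank `2` at every nonzero point over the algebraic closure. -/
def NonsingularIntersection {K : Type*} [Field K] {n : ℕ}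
    (Q₁ Q₂ : MvPolynomial (Fin n) K) : Prop :=
  ∀ x : Fin n → AlgebraicClosure K, x ≠ 0 →
    Matrix.rank (Matrix.of fun (i : Fin 2) (j : Fin n) =>
      MvPolynomial.eval x (MvPolynomial.pderiv j
        (MvPolynomial.map (algebraMap K (AlgebraicClosure K)) (if i = 0 then Q₁ else Q₂)))) = 2

/-- `r(q₁,q₂)`: the maximal rank of a nontrivial form in the pencil, over the algebraic
closure. -/
noncomputable def pencilRmax {K : Type*} [Field K] {n : ℕ}
    (q₁ q₂ : MvPolynomial (Fin n) K) : ℕ :=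
  sSup {m | ∃ a b : AlgebraicClosure K, (a ≠ 0 ∨ b ≠ 0) ∧
    m = qRank (MvPolynomial.C a * MvPolynomial.map (algebraMap K (AlgebraicClosure K)) q₁ +
      MvPolynomial.C b * MvPolynomial.map (algebraMap K (AlgebraicClosure K)) q₂)}

/-- `r_min(q₁,q₂)`: the minimal rank of a nontrivial form in the pencil, over the algebraic
closure. -/
noncomputable def pencilRmin {K : Type*} [Field K] {n : ℕ}
    (q₁ q₂ : MvPolynomial (Fin n) K) : ℕ :=
  sInf {m | ∃ a b : AlgebraicClosure K, (a ≠ 0 ∨ b ≠ 0) ∧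
    m = qRank (MvPolynomial.C a * MvPolynomial.map (algebraMap K (AlgebraicClosure K)) q₁ +
      MvPolynomial.C b * MvPolynomial.map (algebraMap K (AlgebraicClosure K)) q₂)}

/-- `R(q₁,q₂)`: the least `m` such that an invertible change of variables over `K` makes every
form in the pencil (over the algebraic closure) a function of the first `m` variables alone. -/
noncomputable def pencilR {K : Type*} [Field K] {n : ℕ}
    (q₁ q₂ : MvPolynomial (Fin n) K) : ℕ :=
  sInf {m | ∃ T : Matrix (Fin n) (Fin n) K, IsUnit T.det ∧
    ∀ a b : AlgebraicClosure K,
      DependsOnlyOnFirst m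
        (MvPolynomial.C a * MvPolynomial.map (algebraMap K (AlgebraicClosure K)) (substMat T q₁) +
         MvPolynomial.C b * MvPolynomial.map (algebraMap K (AlgebraicClosure K)) (substMat T q₂))}

/-- The symmetrized coefficient matrix `M(q)` of a quadratic form `q = ∑_{i ≤ j} q_{ij}X_iX_j`:
its `(i,j)` entry is `q_{ij}` for `i < j`, `2q_{ii}` for `i = j`, and `q_{ji}` for `i > j`. -/
noncomputable def Mmat {K : Type*} [CommRing K] {n : ℕ}
    (q : MvPolynomial (Fin n) K) : Matrix (Fin n) (Fin n) K :=
  Matrix.of fun i j =>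
    if i < j then q.coeff (Finsupp.single i 1 + Finsupp.single j 1)
    else if i = j then 2 * q.coeff (Finsupp.single i 2)
    else q.coeff (Finsupp.single j 1 + Finsupp.single i 1)

open scoped Matrix

/-- Every quadratic form is a linear combination of the products `X a * X b`. -/
theorem quadratic_induction {R : Type*} [CommRing R] {n : ℕ}
    {P : MvPolynomial (Fin n) R → Prop} (zero : P 0)
    (add : ∀ p q, P p → P q → P (p + q)) (smul : ∀ (a : R) p, P p → P (a • p))
    (X_mul_X : ∀ a b, P (X a * X b)) {q : MvPolynomial (Fin n) R} (hq : q.IsHomogeneous 2) :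
    P q := by
  have h : q ∈ Submodule.span R (Set.range (X : Fin n → MvPolynomial (Fin n) R)) ^ 2 := by
    rw [← homogeneousSubmodule_one_eq_span_X, homogeneousSubmodule_one_pow]
    exact hq
  rw [pow_two, Submodule.span_mul_span] at h
  clear hq
  induction h using Submodule.span_induction with
  | mem p hp =>
    obtain ⟨_, ⟨a, rfl⟩, _, ⟨b, rfl⟩, rfl⟩ := hp
    exact X_mul_X a b
  | zero => exact zero
  | add p q _ _ hp hq => exact add p q hp hq
  | smul a p _ hp => exact smul a p hp

theorem coeff_X_mul_X {R : Type*} [CommRing R] {n : ℕ} (a b i j : Fin n) :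
    (X a * X b : MvPolynomial (Fin n) R).coeff (Finsupp.single i 1 + Finsupp.single j 1) =
      if a = i ∧ b = j ∨ a = j ∧ b = i then 1 else 0 := by
  rw [X, X, monomial_mul, coeff_monomial, mul_one]
  congr 1
  rw [Finsupp.single_add_single_eq_single_add_single one_ne_zero one_ne_zero]
  simp

theorem Mmat_apply {R : Type*} [CommRing R] {n : ℕ} (q : MvPolynomial (Fin n) R) (i j : Fin n) :
    Mmat q i j =
      (if i = j then 2 else 1) * q.coeff (Finsupp.single i 1 + Finsupp.single j 1) := by
  rcases lt_trichotomy i j with h | rfl | h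
  · simp [Mmat, h, h.ne]
  · simp [Mmat, ← Finsupp.single_add]
  · simp [Mmat, h.not_gt, h.ne', add_comm]

theorem Mmat_X_mul_X {R : Type*} [CommRing R] {n : ℕ} (a b i j : Fin n) :
    Mmat (X a * X b : MvPolynomial (Fin n) R) i j =
      (if i = a ∧ j = b then 1 else 0) + (if i = b ∧ j = a then 1 else 0) := by
  rw [Mmat_apply, coeff_X_mul_X]
  by_cases hij : i = j <;> by_cases ha : i = a <;> by_cases hb : j = b <;>
    by_cases ha' : i = b <;> by_cases hb' : j = a <;> grind

/-- The polar form of `q` is given by the matrix `M(q)`. -/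
theorem eval_add_eq {R : Type*} [CommRing R] {n : ℕ} {q : MvPolynomial (Fin n) R}
    (hq : q.IsHomogeneous 2) (v w : Fin n → R) :
    eval (v + w) q = eval v q + eval w q + v ⬝ᵥ Mmat q *ᵥ w := by
  refine quadratic_induction (P := fun q =>
      eval (v + w) q = eval v q + eval w q + v ⬝ᵥ Mmat q *ᵥ w)
    ?_ ?_ ?_ ?_ hq
  · have : Mmat (0 : MvPolynomial (Fin n) R) = 0 := by ext i j; simp [Mmat_apply]
    simp [this]
  · intro p q hp hq
    have : Mmat (p + q) = Mmat p + Mmat q := by ext i j; simp [Mmat_apply, mul_add]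
    rw [this, Matrix.add_mulVec, dotProduct_add, map_add, map_add, map_add, hp, hq]
    ring
  · intro a p hp
    have : Mmat (a • p) = a • Mmat p := by ext i j; simp [Mmat_apply, mul_left_comm]
    rw [this, Matrix.smul_mulVec, dotProduct_smul, smul_eval, smul_eval, smul_eval, hp,
      smul_eq_mul]
    ring
  · intro a b
    have : v ⬝ᵥ Mmat (X a * X b : MvPolynomial (Fin n) R) *ᵥ w = v a * w b + v b * w a := by
      simp [dotProduct, Matrix.mulVec, Mmat_X_mul_X, ite_and, add_mul, Finset.sum_add_distrib,
        mul_add]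
    rw [this]
    simp
    ring

theorem eval_smul_eq {R : Type*} [CommRing R] {n : ℕ} {q : MvPolynomial (Fin n) R}
    (hq : q.IsHomogeneous 2) (a : R) (v : Fin n → R) : eval (a • v) q = a ^ 2 * eval v q := by
  refine quadratic_induction (P := fun q => eval (a • v) q = a ^ 2 * eval v q)
    ?_ ?_ ?_ ?_ hq
  · simp
  · intro p q hp hq
    rw [map_add, map_add, hp, hq, mul_add]
  · intro b p hp
    rw [smul_eval, smul_eval, hp, mul_left_comm]
  · intro i j
    simp; ring

theorem eval_zero_eq {R : Type*} [CommRing R] {n : ℕ} {q : MvPolynomial (Fin n) R}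
    (hq : q.IsHomogeneous 2) : eval 0 q = 0 := by
  simpa using eval_smul_eq hq 0 0

theorem coeff_sq_eq_eval {R : Type*} [CommRing R] {n : ℕ} {q : MvPolynomial (Fin n) R}
    (hq : q.IsHomogeneous 2) (i : Fin n) :
    q.coeff (Finsupp.single i 1 + Finsupp.single i 1) = eval (Pi.single i 1) q := by
  refine quadratic_induction (P := fun q =>
      q.coeff (Finsupp.single i 1 + Finsupp.single i 1) = eval (Pi.single i 1) q)
    ?_ ?_ ?_ ?_ hq
  · simp
  · intro p q hp hq
    rw [map_add, coeff_add, hp, hq]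
  · intro b p hp
    rw [smul_eval, coeff_smul, hp, smul_eq_mul]
  · intro a b
    simp [coeff_X_mul_X, Pi.single_apply, ← ite_and, and_comm]

/-- The translations that leave a quadratic form invariant. -/
def quadRadical {K : Type*} [Field K] {n : ℕ} {q : MvPolynomial (Fin n) K}
    (hq : q.IsHomogeneous 2) : Submodule K (Fin n → K) where
  carrier := {v | ∀ w, eval (v + w) q = eval w q}
  zero_mem' := by simp
  add_mem' := by
    intro u v hu hv w
    rw [add_assoc, hu, hv]
  smul_mem' := by
    intro a v hv w
    rcases eq_or_ne a 0 with rfl | ha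
    · simp
    · rw [← smul_inv_smul₀ ha w, ← smul_add, eval_smul_eq hq, eval_smul_eq hq, hv]

theorem mem_quadRadical {K : Type*} [Field K] {n : ℕ} {q : MvPolynomial (Fin n) K}
    (hq : q.IsHomogeneous 2) {v : Fin n → K} :
    v ∈ quadRadical hq ↔ ∀ w, eval (v + w) q = eval w q := Iff.rfl

theorem eval_eq_zero_of_mem_quadRadical {K : Type*} [Field K] {n : ℕ}
    {q : MvPolynomial (Fin n) K} (hq : q.IsHomogeneous 2) {v : Fin n → K}
    (hv : v ∈ quadRadical hq) : eval v q = 0 := by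
  rw [← add_zero v, hv, eval_zero_eq hq]

theorem dotProduct_eq_zero_of_mem_quadRadical {K : Type*} [Field K] {n : ℕ}
    {q : MvPolynomial (Fin n) K} (hq : q.IsHomogeneous 2) {v : Fin n → K}
    (hv : v ∈ quadRadical hq) (w : Fin n → K) : v ⬝ᵥ Mmat q *ᵥ w = 0 := by
  have h := hv w
  rw [eval_add_eq hq, eval_eq_zero_of_mem_quadRadical hq hv] at h
  simpa using h

/-- A quadratic form does not involve `X i` iff it is invariant under translation along the
`i`-th basis vector. -/
theorem notMem_vars_iff {K : Type*} [Field K] {n : ℕ} {q : MvPolynomial (Fin n) K}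
    (hq : q.IsHomogeneous 2) (i : Fin n) :
    i ∉ q.vars ↔ Pi.single i 1 ∈ quadRadical hq := by
  constructor
  · intro hi w
    refine hom_congr_vars (by ext; simp) (fun j hj _ => ?_) rfl
    have : j ≠ i := by rintro rfl; exact hi hj
    simp [this]
  · intro hi hmem
    obtain ⟨d, hd, hid⟩ := (mem_vars_iff_mem_support i).1 hmem
    have hdeg : d.degree = 2 := by
      by_contra h
      exact mem_support_iff.1 hd (hq.coeff_eq_zero h)
    obtain ⟨e, rfl⟩ : ∃ e, d = Finsupp.single i 1 + e := by
      refine ⟨d - Finsupp.single i 1, (add_tsub_cancel_of_le ?_).symm⟩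
      rw [Finsupp.single_le_iff]
      exact Nat.one_le_iff_ne_zero.2 (Finsupp.mem_support_iff.1 hid)
    obtain ⟨j, rfl⟩ : ∃ j, e = Finsupp.single j 1 := by
      have he : e ∈ {d : Fin n →₀ ℕ | d.degree = 1} := by
        simp at hdeg ⊢
        omega
      rw [← Finsupp.range_single_one] at he
      exact he.imp fun _ => Eq.symm
    apply mem_support_iff.1 hd
    rcases eq_or_ne i j with rfl | hij
    · rw [coeff_sq_eq_eval hq, eval_eq_zero_of_mem_quadRadical hq hi]
    · simpa [Mmat_apply, hij] using
        dotProduct_eq_zero_of_mem_quadRadical hq hi (Pi.single j 1)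

theorem eval_substMat {R : Type*} [CommRing R] {n : ℕ} (T : Matrix (Fin n) (Fin n) R)
    (q : MvPolynomial (Fin n) R) (v : Fin n → R) :
    eval v (substMat T q) = eval (T *ᵥ v) q := by
  rw [substMat, aeval_def, ← coe_eval₂Hom, ← RingHom.comp_apply]
  refine hom_congr_vars (by ext; simp) (fun i _ _ => ?_) rfl
  simp [Matrix.mulVec, dotProduct]

theorem isHomogeneous_substMat {R : Type*} [CommRing R] {n : ℕ} (T : Matrix (Fin n) (Fin n) R)
    {q : MvPolynomial (Fin n) R} (hq : q.IsHomogeneous 2) : (substMat T q).IsHomogeneous 2 := by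
  simpa only [substMat, one_mul] using hq.aeval (n := 1) (fun i => ∑ j, C (T i j) * X j)
    fun i => IsHomogeneous.sum _ _ _ fun j _ => isHomogeneous_C_mul_X _ _

theorem mem_quadRadical_substMat {K : Type*} [Field K] {n : ℕ} {q : MvPolynomial (Fin n) K}
    (hq : q.IsHomogeneous 2) {T : Matrix (Fin n) (Fin n) K} (hT : IsUnit T.det)
    (v : Fin n → K) :
    v ∈ quadRadical (isHomogeneous_substMat T hq) ↔ T *ᵥ v ∈ quadRadical hq := by
  simp only [mem_quadRadical, eval_substMat, Matrix.mulVec_add]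
  refine ⟨fun h w => ?_, fun h w => h _⟩
  have := h (T⁻¹ *ᵥ w)
  rwa [Matrix.mulVec_mulVec, Matrix.mul_nonsing_inv _ hT, Matrix.one_mulVec] at this

theorem dependsOnlyOnFirst_substMat_iff {K : Type*} [Field K] {n : ℕ}
    {q : MvPolynomial (Fin n) K} (hq : q.IsHomogeneous 2) {T : Matrix (Fin n) (Fin n) K}
    (hT : IsUnit T.det) (m : ℕ) :
    DependsOnlyOnFirst m (substMat T q) ↔
      ∀ i : Fin n, m ≤ i → T.col i ∈ quadRadical hq := by
  refine forall_congr' fun i => ?_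
  rw [← not_imp_not, not_lt, notMem_vars_iff (isHomogeneous_substMat T hq),
    mem_quadRadical_substMat hq hT, Matrix.mulVec_single_one]

/-- A subspace of `Kⁿ` of dimension `d` contains the last `d` columns of some invertible
matrix. -/
theorem exists_isUnit_det_col_mem {K : Type*} [Field K] {n : ℕ}
    (V : Submodule K (Fin n → K)) :
    ∃ T : Matrix (Fin n) (Fin n) K, IsUnit T.det ∧
      ∀ i : Fin n, n - Module.finrank K V ≤ i → T.col i ∈ V := by
  obtain ⟨W, hW⟩ := V.exists_isCompl
  have hn : Module.finrank K W + Module.finrank K V = n := by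
    rw [add_comm, Submodule.finrank_add_eq_of_isCompl hW, Module.finrank_fin_fun]
  let b := (((Module.finBasis K W).prod (Module.finBasis K V)).map
    (W.prodEquivOfIsCompl V hW.symm)).reindex (finSumFinEquiv.trans (finCongr hn))
  refine ⟨(Pi.basisFun K (Fin n)).toMatrix b, ?_, fun i hi => ?_⟩
  · rw [← Module.Basis.det_apply]
    exact (Pi.basisFun K (Fin n)).isUnit_det b
  · have hcol : ((Pi.basisFun K (Fin n)).toMatrix b).col i = b i := by
      ext j
      simp [Module.Basis.toMatrix_apply]
    obtain ⟨j, rfl⟩ := (finSumFinEquiv.trans (finCongr hn)).surjective i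
    rw [hcol]
    rcases j with j | j
    · simp at hi
      omega
    · simp [b]

theorem qRank_eq {K : Type*} [Field K] {n : ℕ} {q : MvPolynomial (Fin n) K}
    (hq : q.IsHomogeneous 2) : qRank q = n - Module.finrank K (quadRadical hq) := by
  refine IsLeast.csInf_eq ⟨?_, ?_⟩
  · obtain ⟨T, hT, h⟩ := exists_isUnit_det_col_mem (quadRadical hq)
    exact ⟨T, hT, (dependsOnlyOnFirst_substMat_iff hq hT _).2 h⟩
  · rintro m ⟨T, hT, h⟩
    rw [dependsOnlyOnFirst_substMat_iff hq hT] at h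
    have hli : LinearIndependent K T.col :=
      Matrix.linearIndependent_cols_iff_isUnit.2 ((Matrix.isUnit_iff_isUnit_det T).2 hT)
    have hli' : LinearIndependent K
        (fun i : {i : Fin n // m ≤ i} => (⟨T.col i, h i i.2⟩ : quadRadical hq)) :=
      LinearIndependent.of_comp (quadRadical hq).subtype
        (hli.comp _ Subtype.val_injective)
    have hcard := hli'.fintype_card_le_finrank
    have hsub : Fintype.card {i : Fin n // m ≤ i} = n - m := by
      have := Fintype.card_subtype_compl fun i : Fin n => (i : ℕ) < m
      simp only [not_lt] at this
      rw [this, Fintype.card_subtype, Fin.card_filter_val_lt, Fintype.card_fin]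
      omega
    omega

/-- The inclusion of the hyperplane on which the last coordinate vanishes. -/
def snocZero (K : Type*) [Field K] (n : ℕ) : (Fin n → K) →ₗ[K] (Fin (n + 1) → K) where
  toFun v := Fin.snoc v 0
  map_add' v w := by ext i; cases i using Fin.lastCases <;> simp
  map_smul' a v := by ext i; cases i using Fin.lastCases <;> simp

theorem snocZero_castSucc {K : Type*} [Field K] {n : ℕ} (v : Fin n → K) (i : Fin n) :
    snocZero K n v i.castSucc = v i := by simp [snocZero]

theorem snocZero_last {K : Type*} [Field K] {n : ℕ} (v : Fin n → K) :
    snocZero K n v (Fin.last n) = 0 := by simp [snocZero]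

theorem snocZero_injective (K : Type*) [Field K] (n : ℕ) :
    Function.Injective (snocZero K n) := by
  intro v w h
  ext i
  rw [← snocZero_castSucc v, h, snocZero_castSucc]

theorem exists_snocZero_add {K : Type*} [Field K] {n : ℕ} (v : Fin (n + 1) → K) :
    ∃ u, v = snocZero K n u + v (Fin.last n) • Pi.single (Fin.last n) 1 := by
  refine ⟨fun i => v i.castSucc, ?_⟩
  ext i
  cases i using Fin.lastCases <;> simp [snocZero]

theorem exists_snocZero_eq {K : Type*} [Field K] {n : ℕ} {v : Fin (n + 1) → K}
    (hv : v (Fin.last n) = 0) : ∃ u, v = snocZero K n u := by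
  simpa [hv] using exists_snocZero_add v

/-- The restriction of a polynomial to the hyperplane on which the last variable vanishes. -/
noncomputable def restrictLast {K : Type*} [Field K] {n : ℕ}
    (q : MvPolynomial (Fin (n + 1)) K) : MvPolynomial (Fin n) K :=
  aeval (fun i : Fin (n + 1) =>
    Fin.lastCases (0 : MvPolynomial (Fin n) K) (fun j : Fin n => X j) i) q

theorem eval_restrictLast {K : Type*} [Field K] {n : ℕ} (q : MvPolynomial (Fin (n + 1)) K)
    (v : Fin n → K) : eval v (restrictLast q) = eval (snocZero K n v) q := by
  rw [restrictLast, aeval_def, ← coe_eval₂Hom, ← RingHom.comp_apply]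
  refine hom_congr_vars (by ext; simp) (fun i _ _ => ?_) rfl
  cases i using Fin.lastCases <;> simp [snocZero]

theorem isHomogeneous_restrictLast {K : Type*} [Field K] {n : ℕ}
    {q : MvPolynomial (Fin (n + 1)) K} (hq : q.IsHomogeneous 2) :
    (restrictLast q).IsHomogeneous 2 := by
  simpa only [restrictLast, one_mul] using hq.aeval (n := 1)
    (fun i : Fin (n + 1) =>
      Fin.lastCases (0 : MvPolynomial (Fin n) K) (fun j : Fin n => X j) i)
    fun i => by
      cases i using Fin.lastCases
      · simpa using isHomogeneous_zero (Fin n) K 1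
      · simpa using isHomogeneous_X K _

theorem eval_add_smul_of_tangent {K : Type*} [Field K] {n : ℕ}
    {q : MvPolynomial (Fin (n + 1)) K} (hq : q.IsHomogeneous 2) {x : Fin (n + 1) → K} {c : K}
    (hqx : eval x q = 0) (htangent : (Mmat q).mulVec x = Pi.single (Fin.last n) c)
    (v : Fin (n + 1) → K) (t : K) :
    eval (v + t • x) q = eval v q + t * c * v (Fin.last n) := by
  rw [eval_add_eq hq, eval_smul_eq hq, hqx, Matrix.mulVec_smul, htangent, dotProduct_smul,
    dotProduct_single, smul_eq_mul]
  ring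

/-- Restricting to the tangent hyperplane at `x` adds the line through `x` to the radical. -/
theorem map_quadRadical_restrictLast {K : Type*} [Field K] {n : ℕ}
    {q : MvPolynomial (Fin (n + 1)) K} (hq : q.IsHomogeneous 2) {x : Fin (n + 1) → K} {c : K}
    (hqx : eval x q = 0) (hc : c ≠ 0)
    (htangent : (Mmat q).mulVec x = Pi.single (Fin.last n) c) :
    (quadRadical (isHomogeneous_restrictLast hq)).map (snocZero K n) =
      quadRadical hq ⊔ Submodule.span K {x} := by
  have htan := eval_add_smul_of_tangent hq hqx htangent
  have hxlast : x (Fin.last n) = 0 := by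
    have h := htan x 1
    rw [one_smul, ← two_smul K x, eval_smul_eq hq, hqx] at h
    simpa [hc] using h.symm
  apply le_antisymm
  · rintro _ ⟨v, hv, rfl⟩
    set a : K := snocZero K n v ⬝ᵥ Mmat q *ᵥ Pi.single (Fin.last n) 1
    have hqv : eval (snocZero K n v) q = 0 := by
      rw [← eval_restrictLast]
      exact eval_eq_zero_of_mem_quadRadical _ hv
    have hpolar (w) : snocZero K n v ⬝ᵥ Mmat q *ᵥ w = w (Fin.last n) * a := by
      obtain ⟨u, hu⟩ := exists_snocZero_add w
      have h := hv u
      rw [eval_restrictLast, eval_restrictLast, map_add, eval_add_eq hq, hqv, zero_add,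
        add_eq_left] at h
      conv_lhs => rw [hu]
      rw [Matrix.mulVec_add, dotProduct_add, h, Matrix.mulVec_smul, dotProduct_smul, zero_add,
        smul_eq_mul]
    refine Submodule.mem_sup.2 ⟨snocZero K n v + (-(a / c)) • x, fun w => ?_, (a / c) • x,
      Submodule.smul_mem _ _ (Submodule.mem_span_singleton_self x), ?_⟩
    · rw [add_right_comm, htan, eval_add_eq hq, hqv, hpolar, Pi.add_apply, snocZero_last]
      field_simp
      ring
    · rw [neg_smul, neg_add_cancel_right]
  · refine sup_le (fun v hv => ?_) ?_
    · have hvlast : v (Fin.last n) = 0 := by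
        have h := dotProduct_eq_zero_of_mem_quadRadical hq hv x
        simpa [htangent, hc] using h
      obtain ⟨u, rfl⟩ := exists_snocZero_eq hvlast
      refine ⟨u, fun w => ?_, rfl⟩
      rw [eval_restrictLast, eval_restrictLast, map_add, hv]
    · rw [Submodule.span_singleton_le_iff_mem]
      obtain ⟨u, rfl⟩ := exists_snocZero_eq hxlast
      refine ⟨u, fun w => ?_, rfl⟩
      have h := htan (snocZero K n w) 1
      rw [snocZero_last, one_smul, mul_zero, add_zero] at h
      rw [eval_restrictLast, eval_restrictLast, map_add, add_comm (snocZero K n u), h]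

theorem finrank_quadRadical_restrictLast {K : Type*} [Field K] {n : ℕ}
    {q : MvPolynomial (Fin (n + 1)) K} (hq : q.IsHomogeneous 2) {x : Fin (n + 1) → K} {c : K}
    (hqx : eval x q = 0) (hc : c ≠ 0)
    (htangent : (Mmat q).mulVec x = Pi.single (Fin.last n) c) :
    Module.finrank K (quadRadical (isHomogeneous_restrictLast hq)) =
      Module.finrank K (quadRadical hq) + 1 := by
  have hx : x ∉ quadRadical hq := by
    intro h
    have h' := eval_add_smul_of_tangent hq hqx htangent (Pi.single (Fin.last n) 1) 1
    rw [one_smul, add_comm _ x, h] at h'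
    simp [hc] at h'
  have hx0 : x ≠ 0 := fun h => hx (h ▸ Submodule.zero_mem _)
  have h := Submodule.finrank_sup_add_finrank_inf_eq (quadRadical hq)
    (Submodule.span K {x})
  rw [((Submodule.disjoint_span_singleton' hx0).2 hx).eq_bot, finrank_bot, add_zero,
    finrank_span_singleton hx0, ← map_quadRadical_restrictLast hq hqx hc htangent] at h
  rw [← h]
  exact (Submodule.equivMapOfInjective _ (snocZero_injective K n) _).finrank_eq

/-- Lemma `add`: let `q` be a quadratic form in `n+1` variables of rank `r`
over a field `K`, and suppose the hyperplane `X_n = 0` (the last coordinate) is tangent to the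
quadric `q = 0` at a nonsingular point `x` (i.e. `q(x) = 0`, `x ≠ 0`, and the gradient
`M(q)·x` is a nonzero multiple of the last coordinate functional).  Then the restricted form
`q(X_0,…,X_{n-1},0)`, viewed as a form in `n` variables, has rank `r - 2`. -/
theorem stmt_7 {K : Type*} [Field K] {n : ℕ}
    (q : MvPolynomial (Fin (n + 1)) K) (hq : q.IsHomogeneous 2)
    (r : ℕ) (hr : qRank q = r)
    (x : Fin (n + 1) → K) (hx : x ≠ 0) (hqx : MvPolynomial.eval x q = 0)
    (c : K) (hc : c ≠ 0)
    (htangent : (Mmat q).mulVec x = Pi.single (Fin.last n) c) :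
    qRank (MvPolynomial.aeval
      (fun i : Fin (n + 1) =>
        Fin.lastCases (0 : MvPolynomial (Fin n) K) (fun j : Fin n => MvPolynomial.X j) i)
      q) = r - 2 := by
  subst hr
  change qRank (restrictLast q) = _
  rw [qRank_eq hq, qRank_eq (isHomogeneous_restrictLast hq),
    finrank_quadRadical_restrictLast hq hqx hc htangent]
  omega
end

section
/- Let F_v be the residue field of the completion of a number field at a non-archimedean place, with characteristic 2, and let P be a pencil of quadratic forms in n variables over F_v with #F_v ≥ n; write r = r(P) and R = R(P), suppose r < R and that r is odd. Then there is a basis q_1, q_2 for P with rank(q_1) = r, and for any such basis there is an invertible change of variables over F_v such that q_1(X_1,...,X_n) = q_1'(X_1,...,X_r) and q_2 is of one of the three shapes: q_2 = q_2'(X_1,...,X_{R-1}) + X_r X_R, or q_2 = q_2'(X_1,...,X_r) + X_{r+1}², or q_2 = q_2'(X_1,...,X_r) + X_{r+1}² + X_r X_{r+1}. Moreover, when r ≤ R - 2 one can always take q_2 of the first shape. -/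
open MvPolynomial NumberField IsDedekindDomain

theorem finite_residueField_adicCompletionIntegers (k : Type*) [Field k] [NumberField k]
    (v : HeightOneSpectrum (𝓞 k)) :
    Finite (IsLocalRing.ResidueField (v.adicCompletionIntegers k)) := by
  have : Finite (𝓞 k ⧸ v.asIdeal) := Ideal.finiteQuotientOfFreeOfNeBot _ v.ne_bot
  let O := v.adicCompletionIntegers k
  have hmem (x : O) : x ∈ IsLocalRing.maximalIdeal O ↔ Valued.v (x : v.adicCompletion k) < 1 := by
    rw [IsLocalRing.mem_maximalIdeal, mem_nonunits_iff,
      HeightOneSpectrum.adicCompletionIntegers.isUnit_iff_valued_eq_one]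
    exact ⟨fun h ↦ lt_of_le_of_ne x.2 h, fun h ↦ h.ne⟩
  let f : 𝓞 k →+* IsLocalRing.ResidueField O :=
    (IsLocalRing.residue O).comp (algebraMap (𝓞 k) O)
  have hf : ∀ a ∈ v.asIdeal, f a = 0 := fun a ha ↦ by
    refine (IsLocalRing.residue_eq_zero_iff _).2 ((hmem _).2 ?_)
    rw [HeightOneSpectrum.algebraMap_adicCompletionIntegers_apply]
    exact (HeightOneSpectrum.valuedAdicCompletion_eq_valuation v a).trans_lt
      ((v.valuation_lt_one_iff_mem a).2 ha)
  refine Finite.of_surjective (Ideal.Quotient.lift v.asIdeal f hf)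
    (Ideal.Quotient.lift_surjective_of_surjective _ hf fun y ↦ ?_)
  obtain ⟨y, rfl⟩ := IsLocalRing.residue_surjective y
  obtain ⟨x, hx⟩ : ∃ x : k, Valued.v ((x : v.adicCompletion k) - y) < 1 := by
    have ho : IsOpen {z : v.adicCompletion k | Valued.v (z - y) < 1} := by
      have : IsOpen {z : v.adicCompletion k | Valued.v z < 1} := by
        simpa only [Valuation.restrict_lt_one_iff] using Valued.isOpen_ball (v.adicCompletion k) 1
      exact this.preimage (continuous_id.sub continuous_const)
    obtain ⟨x, hx⟩ := (HeightOneSpectrum.denseRange_algebraMap k v).exists_mem_open ho ⟨y, by simp⟩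
    exact ⟨x, hx⟩
  have hx1 : v.valuation k x ≤ 1 := by
    rw [← HeightOneSpectrum.valuedAdicCompletion_eq_valuation']
    have := Valuation.map_add Valued.v ((x : v.adicCompletion k) - y) y
    rw [sub_add_cancel] at this
    exact this.trans (max_le hx.le y.2)
  obtain ⟨a, ha⟩ := v.exists_valuation_sub_lt_of_integer hx1 1
  refine ⟨a, ?_⟩
  change IsLocalRing.residue O _ = _
  rw [← sub_eq_zero, ← map_sub, IsLocalRing.residue_eq_zero_iff, hmem]
  rw [← HeightOneSpectrum.valuedAdicCompletion_eq_valuation'] at ha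
  have hsum : algebraMap k (v.adicCompletion k) (algebraMap (𝓞 k) k a) - y =
      algebraMap k (v.adicCompletion k) (algebraMap (𝓞 k) k a - x) +
        (algebraMap k (v.adicCompletion k) x - y) := by
    rw [map_sub]; ring
  change Valued.v (algebraMap k (v.adicCompletion k) (algebraMap (𝓞 k) k a) - y) < 1
  rw [hsum]
  exact (Valuation.map_add Valued.v _ _).trans_lt (max_lt ha hx)

section QuadraticMatrix

open Matrix

variable {K ι : Type*} [Field K] [Fintype ι]

theorem quad_add (C : Matrix ι ι K) (x y : ι → K) :
    (x + y) ⬝ᵥ C *ᵥ (x + y) = x ⬝ᵥ C *ᵥ x + y ⬝ᵥ C *ᵥ y + x ⬝ᵥ (C + Cᵀ) *ᵥ y := by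
  have h : x ⬝ᵥ Cᵀ *ᵥ y = y ⬝ᵥ C *ᵥ x := by
    rw [mulVec_transpose, dotProduct_comm, dotProduct_mulVec]
  simp only [mulVec_add, add_dotProduct, dotProduct_add, add_mulVec, h]
  ring

theorem quad_smul (C : Matrix ι ι K) (c : K) (x : ι → K) :
    (c • x) ⬝ᵥ C *ᵥ (c • x) = c ^ 2 * (x ⬝ᵥ C *ᵥ x) := by
  simp only [mulVec_smul, smul_dotProduct, dotProduct_smul, smul_eq_mul]
  ring

/-- The vertex of the quadratic form `x ↦ xᵀ C x`: the zeros of the form in the radical of its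
polar form. -/
def quadVertex (C : Matrix ι ι K) : Submodule K (ι → K) where
  carrier := {x | x ⬝ᵥ C *ᵥ x = 0 ∧ (C + Cᵀ) *ᵥ x = 0}
  zero_mem' := by simp
  add_mem' := by
    rintro x y ⟨hx, hx'⟩ ⟨hy, hy'⟩
    exact ⟨by rw [quad_add, hx, hy, hy']; simp, by rw [mulVec_add, hx', hy', add_zero]⟩
  smul_mem' := by
    rintro c x ⟨hx, hx'⟩
    exact ⟨by rw [quad_smul, hx, mul_zero], by rw [mulVec_smul, hx', smul_zero]⟩

theorem mem_quadVertex {C : Matrix ι ι K} {x : ι → K} :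
    x ∈ quadVertex C ↔ x ⬝ᵥ C *ᵥ x = 0 ∧ (C + Cᵀ) *ᵥ x = 0 := Iff.rfl

theorem quadVertex_smul (C : Matrix ι ι K) {c : K} (hc : c ≠ 0) :
    quadVertex (c • C) = quadVertex C := by
  ext x
  simp [mem_quadVertex, smul_mulVec, ← smul_add, hc]

theorem quadVertex_inf_quadVertex_le (C D : Matrix ι ι K) (a b : K) :
    quadVertex C ⊓ quadVertex D ≤ quadVertex (a • C + b • D) := by
  rintro x ⟨⟨h₁, h₂⟩, h₃, h₄⟩
  refine ⟨by simp [add_mulVec, smul_mulVec, h₁, h₃], ?_⟩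
  have : a • C + b • D + (a • C + b • D)ᵀ = a • (C + Cᵀ) + b • (D + Dᵀ) := by
    simp only [transpose_add, transpose_smul, smul_add]; abel
  rw [this, add_mulVec, smul_mulVec, smul_mulVec, h₂, h₄]; simp

theorem quadVertex_inf_quadVertex_eq (C D : Matrix ι ι K) {a b c d : K} (h : a * d - b * c ≠ 0) :
    quadVertex (a • C + b • D) ⊓ quadVertex (c • C + d • D) = quadVertex C ⊓ quadVertex D := by
  refine le_antisymm (le_inf ?_ ?_)
    (le_inf (quadVertex_inf_quadVertex_le _ _ _ _) (quadVertex_inf_quadVertex_le _ _ _ _))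
  · rw [← quadVertex_smul C h]
    convert quadVertex_inf_quadVertex_le _ _ d (-b) using 2
    module
  · rw [← quadVertex_smul D h]
    convert quadVertex_inf_quadVertex_le _ _ (-c) a using 2
    module

end QuadraticMatrix

section QuadraticPolynomial

open Matrix

variable {K : Type*} [Field K] {n : ℕ}

/-- The quadratic form `∑ C i j X_i X_j`. -/
noncomputable def quadPoly (C : Matrix (Fin n) (Fin n) K) : MvPolynomial (Fin n) K :=
  ∑ i, ∑ j, monomial (Finsupp.single i 1 + Finsupp.single j 1) (C i j)

theorem quadPoly_eq_sum (C : Matrix (Fin n) (Fin n) K) :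
    quadPoly C = ∑ i, ∑ j, MvPolynomial.C (C i j) * (X i * X j) := by
  simp [quadPoly, X, C_mul_monomial, monomial_mul]

theorem quadPoly_add (C D : Matrix (Fin n) (Fin n) K) :
    quadPoly (C + D) = quadPoly C + quadPoly D := by
  simp [quadPoly, Finset.sum_add_distrib]

theorem quadPoly_smul (a : K) (C : Matrix (Fin n) (Fin n) K) :
    quadPoly (a • C) = MvPolynomial.C a * quadPoly C := by
  simp [quadPoly, Finset.mul_sum, C_mul_monomial]

theorem quadPoly_single (i j : Fin n) : quadPoly (Matrix.single i j (1 : K)) = X i * X j := by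
  rw [quadPoly_eq_sum, Finset.sum_eq_single i (by simp +contextual [eq_comm])
    (by simp), Finset.sum_eq_single j (by simp +contextual [eq_comm]) (by simp)]
  simp

theorem map_quadPoly {L : Type*} [Field L] (f : K →+* L) (C : Matrix (Fin n) (Fin n) K) :
    MvPolynomial.map f (quadPoly C) = quadPoly (C.map f) := by
  simp [quadPoly]

theorem substMat_quadPoly (T C : Matrix (Fin n) (Fin n) K) :
    substMat T (quadPoly C) = quadPoly (Tᵀ * C * T) := by
  have h (g : Fin n → MvPolynomial (Fin n) K) (C : Matrix (Fin n) (Fin n) K) :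
      aeval g (quadPoly C) = g ⬝ᵥ C.map MvPolynomial.C *ᵥ g := by
    simp only [quadPoly_eq_sum, dotProduct, mulVec, Finset.mul_sum, Matrix.map_apply, map_sum,
      map_mul, aeval_X, algHom_C, algebraMap_eq]
    exact Finset.sum_congr rfl fun i _ ↦ Finset.sum_congr rfl fun j _ ↦ by ring
  have hX : (fun i ↦ ∑ j, MvPolynomial.C (T i j) * X j) = T.map MvPolynomial.C *ᵥ
      (X : Fin n → MvPolynomial (Fin n) K) := rfl
  rw [substMat, hX, h, ← aeval_X_left_apply (quadPoly (Tᵀ * C * T)), h, Matrix.map_mul,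
    Matrix.map_mul, ← mulVec_mulVec, ← mulVec_mulVec, transpose_map, dotProduct_transpose_mulVec]
  exact dotProduct_comm _ _

theorem single_add_single_eq_iff (a b i j : Fin n) :
    (Finsupp.single a 1 + Finsupp.single b 1 : Fin n →₀ ℕ) =
      Finsupp.single i 1 + Finsupp.single j 1 ↔ (a = i ∧ b = j) ∨ (a = j ∧ b = i) := by
  rw [Finsupp.single_add_single_eq_single_add_single one_ne_zero one_ne_zero]
  simp

theorem coeff_quadPoly (C : Matrix (Fin n) (Fin n) K) (i j : Fin n) :
    coeff (Finsupp.single i 1 + Finsupp.single j 1) (quadPoly C) =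
      if i = j then C i i else C i j + C j i := by
  simp only [quadPoly, coeff_sum, coeff_monomial, single_add_single_eq_iff]
  split_ifs with h
  · subst h
    rw [Finset.sum_eq_single i (by simp +contextual) (by simp),
      Finset.sum_eq_single i (by simp +contextual) (by simp)]
    simp
  · have (a b : Fin n) : (if (a = i ∧ b = j) ∨ (a = j ∧ b = i) then C a b else 0) =
        (if a = i then if b = j then C a b else 0 else 0) +
          (if a = j then if b = i then C a b else 0 else 0) := by
      grind
    simp [this, Finset.sum_add_distrib]

theorem eq_single_add_single_of_degree_eq_two {d : Fin n →₀ ℕ} (hd : d.degree = 2) :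
    ∃ i j, i ≤ j ∧ d = Finsupp.single i 1 + Finsupp.single j 1 := by
  obtain ⟨a, b, hab⟩ := Multiset.card_eq_two.1 ((Finsupp.card_toMultiset d).trans hd)
  have : d = Finsupp.single a 1 + Finsupp.single b 1 := by
    rw [← Finsupp.toMultiset_toFinsupp d, hab, Multiset.insert_eq_cons, ← Multiset.singleton_add,
      map_add, Multiset.toFinsupp_singleton, Multiset.toFinsupp_singleton]
  rcases le_total a b with h | h
  · exact ⟨a, b, h, this⟩
  · exact ⟨b, a, h, by rw [this, add_comm]⟩

theorem isHomogeneous_quadPoly (C : Matrix (Fin n) (Fin n) K) : (quadPoly C).IsHomogeneous 2 :=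
  IsHomogeneous.sum _ _ _ fun i _ ↦ IsHomogeneous.sum _ _ _ fun j _ ↦
    isHomogeneous_monomial _ (by simp)

theorem exists_eq_quadPoly {p : MvPolynomial (Fin n) K} (hp : p.IsHomogeneous 2) :
    ∃ C, p = quadPoly C := by
  refine ⟨.of fun i j ↦ if i ≤ j then coeff (Finsupp.single i 1 + Finsupp.single j 1) p else 0, ?_⟩
  ext d
  by_cases hd : d.degree = 2
  · obtain ⟨i, j, hij, rfl⟩ := eq_single_add_single_of_degree_eq_two hd
    rw [coeff_quadPoly]
    split_ifs with h
    · subst h; simp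
    · simp [hij, (lt_of_le_of_ne hij h).not_ge]
  · rw [hp.coeff_eq_zero hd, (isHomogeneous_quadPoly _).coeff_eq_zero hd]

theorem dependsOnlyOnFirst_quadPoly {m : ℕ} {D : Matrix (Fin n) (Fin n) K} :
    DependsOnlyOnFirst m (quadPoly D) ↔
      ∀ i : Fin n, m ≤ i → D i i = 0 ∧ ∀ j, j ≠ i → D i j + D j i = 0 := by
  constructor
  · intro h i hi
    have hcoeff (j : Fin n) : coeff (Finsupp.single i 1 + Finsupp.single j 1) (quadPoly D) = 0 := by
      by_contra hne
      refine (h i ((mem_vars_iff_mem_support i).2 ⟨_, mem_support_iff.2 hne, ?_⟩)).not_ge hi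
      simp
    refine ⟨by simpa [coeff_quadPoly] using hcoeff i, fun j hj ↦ ?_⟩
    simpa [coeff_quadPoly, hj.symm] using hcoeff j
  · intro h i hi
    by_contra! hmi
    obtain ⟨d, hd, hid⟩ := (mem_vars_iff_mem_support i).1 hi
    rw [mem_support_iff] at hd
    obtain ⟨a, b, -, rfl⟩ := eq_single_add_single_of_degree_eq_two
      (not_not.1 fun hne ↦ hd ((isHomogeneous_quadPoly D).coeff_eq_zero hne))
    rw [coeff_quadPoly] at hd
    have hab : i = a ∨ i = b := by
      by_contra! hne
      simp [hne.1.symm, hne.2.symm] at hid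
    obtain ⟨h₁, h₂⟩ := h i hmi
    grind

theorem transpose_mul_mul_apply (T C : Matrix (Fin n) (Fin n) K) (i j : Fin n) :
    (Tᵀ * C * T) i j = T.col i ⬝ᵥ C *ᵥ T.col j := by
  rw [Matrix.mul_assoc]; rfl

theorem dependsOnlyOnFirst_substMat {m : ℕ} {T C : Matrix (Fin n) (Fin n) K} (hT : IsUnit T.det) :
    DependsOnlyOnFirst m (substMat T (quadPoly C)) ↔
      ∀ i : Fin n, m ≤ i → T.col i ∈ quadVertex C := by
  rw [substMat_quadPoly, dependsOnlyOnFirst_quadPoly]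
  have hpolar (i j : Fin n) : (Tᵀ * C * T) i j + (Tᵀ * C * T) j i =
      (Tᵀ *ᵥ ((C + Cᵀ) *ᵥ T.col i)) j := by
    rw [transpose_mul_mul_apply, transpose_mul_mul_apply, ← dotProduct_transpose_mulVec,
      ← dotProduct_add, add_comm, ← add_mulVec]
    rfl
  refine forall₂_congr fun i hi ↦ ?_
  rw [mem_quadVertex, transpose_mul_mul_apply]
  refine and_congr_right fun h0 ↦ ?_
  have hinj : Function.Injective Tᵀ.mulVec := by
    rw [mulVec_injective_iff_isUnit, isUnit_iff_isUnit_det, det_transpose]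
    exact hT
  rw [← (hinj.eq_iff' (mulVec_zero _)), funext_iff]
  refine forall_congr' fun j ↦ ?_
  rw [← hpolar]
  by_cases hj : j = i
  · subst hj; simp [transpose_mul_mul_apply, h0]
  · simp [hj]

end QuadraticPolynomial

section AdaptedBasis

open Matrix Module

variable {K : Type*} [Field K] {n : ℕ}

theorem finrank_span_image_Ioi_lt (f : Fin n → Fin n → K) (i : Fin n) :
    finrank K (Submodule.span K (f '' Set.Ioi i)) + i < n := by
  classical
  have h := finrank_span_finset_le_card (R := K) ((Finset.Ioi i).image f)
  have h' : ((Finset.Ioi i).image f).card ≤ n - 1 - i := by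
    simpa using Finset.card_image_le (s := Finset.Ioi i) (f := f)
  rw [Finset.coe_image, Finset.coe_Ioi] at h
  unfold Set.finrank at h
  have := i.2
  omega

/-- An invertible matrix with columns in prescribed sets, built from the last column on. -/
theorem exists_isUnit_det_forall_col_mem (S : Fin n → Set (Fin n → K))
    (h : ∀ i (f : Fin n → Fin n → K), (∀ j, i < j → f j ∈ S j) →
      ∃ w ∈ S i, w ∉ Submodule.span K (f '' Set.Ioi i)) :
    ∃ T : Matrix (Fin n) (Fin n) K, IsUnit T.det ∧ ∀ i, T.col i ∈ S i := by
  have key (m : ℕ) (hm : m ≤ n) : ∃ f : Fin n → Fin n → K,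
      LinearIndepOn K f {j | n ≤ j + m} ∧ ∀ j : Fin n, n ≤ j + m → f j ∈ S j := by
    induction m with
    | zero =>
      have : {j : Fin n | n ≤ j + 0} = ∅ := by ext j; simp
      exact ⟨0, by rw [this]; exact linearIndepOn_empty K _, fun j hj ↦ by omega⟩
    | succ m ih =>
      obtain ⟨f, hf, hfS⟩ := ih (by omega)
      let i : Fin n := ⟨n - (m + 1), by omega⟩
      have hIoi : {j : Fin n | n ≤ j + m} = Set.Ioi i := by
        ext j; simp [i, Fin.lt_def]; omega
      have hins : {j : Fin n | n ≤ j + (m + 1)} = insert i (Set.Ioi i) := by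
        ext j
        simp only [Set.mem_ofPred_eq, Set.mem_insert_iff, Set.mem_Ioi, i, Fin.lt_def, Fin.ext_iff]
        omega
      obtain ⟨w, hw, hwf⟩ := h i f fun j hj ↦ hfS j (hIoi.ge hj)
      have hS : Set.EqOn (Function.update f i w) f (Set.Ioi i) := fun j hj ↦
        Function.update_of_ne (ne_of_gt hj) _ _
      refine ⟨Function.update f i w, ?_, fun j hj ↦ ?_⟩
      · rw [hins, linearIndepOn_insert (by simp), hS.image_eq, Function.update_self]
        exact ⟨(hIoi ▸ hf).congr hS.symm, hwf⟩
      · by_cases hij : j = i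
        · subst hij; simpa using hw
        · rw [Function.update_of_ne hij]
          refine hfS j ?_
          have : (j : ℕ) ≠ i := fun h ↦ hij (Fin.ext h)
          simp only [i] at this
          omega
  obtain ⟨f, hf, hfS⟩ := key n le_rfl
  refine ⟨(Matrix.of f)ᵀ, ?_, fun i ↦ hfS i (by omega)⟩
  rw [← isUnit_iff_isUnit_det, ← linearIndependent_cols_iff_isUnit]
  have : {j : Fin n | n ≤ j + n} = Set.univ := by ext; simp
  rw [this, linearIndepOn_univ_iff] at hf
  exact hf

theorem sInf_setOf_exists_isUnit_det_col_mem (N : Submodule K (Fin n → K)) :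
    sInf {m : ℕ | ∃ T : Matrix (Fin n) (Fin n) K, IsUnit T.det ∧ ∀ i : Fin n, m ≤ i → T.col i ∈ N} =
      n - finrank K N := by
  refine IsLeast.csInf_eq ⟨?_, ?_⟩
  · obtain ⟨T, hT, h⟩ := exists_isUnit_det_forall_col_mem
      (fun i : Fin n ↦ {x | n - finrank K N ≤ i → x ∈ N}) fun i f hf ↦ by
        have hlt := finrank_span_image_Ioi_lt f i
        by_cases hi : n - finrank K N ≤ i
        · obtain ⟨w, hw, hw'⟩ := SetLike.not_le_iff_exists.1
            (fun hle ↦ by have := Submodule.finrank_mono hle; omega :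
              ¬ N ≤ Submodule.span K (f '' Set.Ioi i))
          exact ⟨w, fun _ ↦ hw, hw'⟩
        · obtain ⟨w, hw, hw'⟩ := SetLike.not_le_iff_exists.1
            (fun hle ↦ by have := Submodule.finrank_mono hle; simp at this; omega :
              ¬ ⊤ ≤ Submodule.span K (f '' Set.Ioi i))
          exact ⟨w, fun h ↦ (hi h).elim, hw'⟩
    exact ⟨T, hT, h⟩
  · rintro m ⟨T, hT, h⟩
    rw [← isUnit_iff_isUnit_det, ← linearIndependent_cols_iff_isUnit] at hT
    by_contra! hm
    let g : {i : Fin n // m ≤ i} → N := fun i ↦ ⟨T.col i, h i i.2⟩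
    have hg : LinearIndependent K g :=
      LinearIndependent.of_comp N.subtype (hT.comp _ Subtype.val_injective)
    have := hg.fintype_card_le_finrank
    rw [Fintype.card_subtype] at this
    have hc : (Finset.univ.filter fun i : Fin n ↦ m ≤ i).card = n - m := by
      have : (Finset.univ.filter fun i : Fin n ↦ m ≤ i) = Finset.Ici ⟨m, by omega⟩ := by
        ext; simp [Fin.le_def]
      rw [this, Fin.card_Ici]
    omega

end AdaptedBasis

section Rank

open Matrix Module

variable {K : Type*} [Field K] {n : ℕ}

theorem qRank_quadPoly (C : Matrix (Fin n) (Fin n) K) :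
    qRank (quadPoly C) = n - finrank K (quadVertex C) := by
  rw [← sInf_setOf_exists_isUnit_det_col_mem, qRank]
  exact congrArg sInf (Set.ext fun m ↦ exists_congr fun T ↦ and_congr_right fun hT ↦
    dependsOnlyOnFirst_substMat hT)

theorem pencilR_quadPoly (C D : Matrix (Fin n) (Fin n) K) :
    pencilR (quadPoly C) (quadPoly D) =
      n - finrank K ↥(quadVertex C ⊓ quadVertex D) := by
  rw [← sInf_setOf_exists_isUnit_det_col_mem, pencilR]
  refine congrArg sInf (Set.ext fun m ↦ exists_congr fun T ↦ and_congr_right fun hT ↦ ?_)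
  have hmap (D : Matrix (Fin n) (Fin n) K) : DependsOnlyOnFirst m
      (MvPolynomial.map (algebraMap K (AlgebraicClosure K)) (substMat T (quadPoly D))) ↔
      ∀ i : Fin n, m ≤ i → T.col i ∈ quadVertex D := by
    rw [← dependsOnlyOnFirst_substMat hT, DependsOnlyOnFirst,
      vars_map_of_injective _ (algebraMap K _).injective]
    rfl
  simp only [Submodule.mem_inf, forall_and, ← hmap]
  constructor
  · exact fun h ↦ ⟨by simpa using h 1 0, by simpa using h 0 1⟩
  · rintro ⟨h₁, h₂⟩ a b
    simp only [substMat_quadPoly, map_quadPoly, ← quadPoly_smul, ← quadPoly_add,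
      dependsOnlyOnFirst_quadPoly] at h₁ h₂ ⊢
    intro i hi
    refine ⟨?_, fun j hj ↦ ?_⟩
    · rw [Matrix.add_apply, Matrix.smul_apply, Matrix.smul_apply, (h₁ i hi).1, (h₂ i hi).1]
      simp
    have h₁ := (h₁ i hi).2 j hj
    have h₂ := (h₂ i hi).2 j hj
    simp only [Matrix.add_apply, Matrix.smul_apply, smul_eq_mul]
    linear_combination a * h₁ + b * h₂

end Rank

section RankFactorization

open Matrix Module

variable {K : Type*} [Field K] {m n : Type*} [Fintype n]

theorem exists_mul_mul_eq_one [Fintype m] (B : Matrix m n K) :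
    ∃ (P : Matrix (Fin B.rank) m K) (Q : Matrix n (Fin B.rank) K), P * B * Q = 1 := by
  classical
  let b : Basis (Fin B.rank) K (LinearMap.range B.mulVecLin) := finBasis K _
  choose q hq using fun i ↦ (b i).2
  let Q : Matrix n (Fin B.rank) K := (Matrix.of q)ᵀ
  have hBQ : LinearIndependent K (B * Q).col := by
    have : (B * Q).col = fun i ↦ (b i : m → K) := funext fun i ↦ hq i
    rw [this]
    exact b.linearIndependent.map' (Submodule.subtype _) (Submodule.ker_subtype _)
  obtain ⟨g, hg⟩ := LinearMap.exists_leftInverse_of_injective (B * Q).mulVecLin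
    (LinearMap.ker_eq_bot.2 (mulVec_injective_iff.2 hBQ))
  refine ⟨LinearMap.toMatrix' g, Q, ?_⟩
  apply Matrix.toLin'.injective
  rw [Matrix.mul_assoc, toLin'_mul, toLin'_toMatrix', toLin'_one]
  exact hg

theorem rank_le_rank_map [Fintype m] {L : Type*} [Field L] (f : K →+* L) (B : Matrix m n K) :
    B.rank ≤ (B.map f).rank := by
  obtain ⟨P, Q, h⟩ := exists_mul_mul_eq_one B
  have h' : P.map f * B.map f * Q.map f = 1 := by
    rw [← Matrix.map_mul, ← Matrix.map_mul, h, Matrix.map_one _ (map_zero f) (map_one f)]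
  calc B.rank = (P.map f * B.map f * Q.map f).rank := by rw [h', rank_one, Fintype.card_fin]
    _ ≤ (P.map f * B.map f).rank := rank_mul_le_left _ _
    _ ≤ _ := rank_mul_le_right _ _

theorem rank_add_finrank_ker (B : Matrix m n K) :
    B.rank + finrank K (LinearMap.ker B.mulVecLin) = Fintype.card n := by
  rw [Matrix.rank, LinearMap.finrank_range_add_finrank_ker, finrank_fintype_fun_eq_card]

end RankFactorization

section Perfect

open Matrix Module

variable {K ι : Type*} [Field K] [CharP K 2] [PerfectRing K 2] [Fintype ι]

/-- Over a perfect field of characteristic two, a quadratic form is the square of a linear form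
on every subspace on which its polar form vanishes. -/
theorem exists_linearMap_sq_eq_quad (C : Matrix ι ι K) (S : Submodule K (ι → K))
    (hS : ∀ x ∈ S, ∀ y ∈ S, x ⬝ᵥ (C + Cᵀ) *ᵥ y = 0) :
    ∃ φ : S →ₗ[K] K, ∀ x : S, φ x ^ 2 = (x : ι → K) ⬝ᵥ C *ᵥ x := by
  have hsq (a : K) : (frobeniusEquiv K 2).symm a ^ 2 = a :=
    frobeniusEquiv_symm_pow_p K 2 a
  refine ⟨⟨⟨fun x ↦ (frobeniusEquiv K 2).symm ((x : ι → K) ⬝ᵥ C *ᵥ x), fun x y ↦ ?_⟩,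
    fun c x ↦ ?_⟩, fun x ↦ hsq _⟩
  · rw [← map_add]
    simp only [Submodule.coe_add]
    rw [quad_add, hS x x.2 y y.2, add_zero]
  · simp only [Submodule.coe_smul, RingHom.id_apply]
    rw [quad_smul, map_mul, frobeniusEquiv_symm_pow, smul_eq_mul]

theorem finrank_le_finrank_add_one (C : Matrix ι ι K) (S M : Submodule K (ι → K))
    (hS : ∀ x ∈ S, ∀ y ∈ S, x ⬝ᵥ (C + Cᵀ) *ᵥ y = 0)
    (hM : ∀ x ∈ S, x ⬝ᵥ C *ᵥ x = 0 → x ∈ M) : finrank K S ≤ finrank K M + 1 := by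
  obtain ⟨φ, hφ⟩ := exists_linearMap_sq_eq_quad C S hS
  have h1 : finrank K (LinearMap.range φ) ≤ 1 := by
    simpa using Submodule.finrank_le (LinearMap.range φ)
  have h2 : finrank K (LinearMap.ker φ) ≤ finrank K M := by
    rw [(Submodule.equivMapOfInjective S.subtype S.subtype_injective _).finrank_eq]
    refine Submodule.finrank_mono ?_
    rintro _ ⟨x, hx, rfl⟩
    exact hM x x.2 (by rw [← hφ, LinearMap.mem_ker.1 hx]; simp)
  have := φ.finrank_range_add_finrank_ker
  omega

theorem finrank_quadVertex_map_le {L : Type*} [Field L] (f : K →+* L) (C : Matrix ι ι K) :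
    finrank L (quadVertex (C.map f)) ≤ finrank K (quadVertex C) := by
  have hmap : C.map f + (C.map f)ᵀ = (C + Cᵀ).map f := by
    rw [← transpose_map, ← Matrix.map_add f (map_add f)]
  have hker : finrank L (LinearMap.ker (C.map f + (C.map f)ᵀ).mulVecLin) ≤
      finrank K (LinearMap.ker (C + Cᵀ).mulVecLin) := by
    have h1 := rank_add_finrank_ker (C + Cᵀ)
    have h2 := rank_add_finrank_ker (C.map f + (C.map f)ᵀ)
    have h3 := rank_le_rank_map f (C + Cᵀ)
    rw [← hmap] at h3
    omega
  have hle : quadVertex (C.map f) ≤ LinearMap.ker (C.map f + (C.map f)ᵀ).mulVecLin :=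
    fun x hx ↦ hx.2
  by_cases h : ∀ x ∈ LinearMap.ker (C + Cᵀ).mulVecLin, x ⬝ᵥ C *ᵥ x = 0
  · exact (Submodule.finrank_mono hle).trans (hker.trans (Submodule.finrank_mono fun x hx ↦
      ⟨h x hx, hx⟩))
  · push Not at h
    obtain ⟨x, hx, hx0⟩ := h
    have hlt : quadVertex (C.map f) < LinearMap.ker (C.map f + (C.map f)ᵀ).mulVecLin := by
      refine lt_of_le_not_ge hle fun hge ↦ hx0 ?_
      have hx' : f ∘ x ∈ LinearMap.ker (C.map f + (C.map f)ᵀ).mulVecLin := by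
        rw [LinearMap.mem_ker, mulVecLin_apply] at hx ⊢
        ext i
        rw [hmap, ← RingHom.map_mulVec, hx]
        simp
      have hC : C.map f *ᵥ (f ∘ x) = f ∘ (C *ᵥ x) := funext fun i ↦ (f.map_mulVec C x i).symm
      have h0 := (hge hx').1
      rwa [hC, ← f.map_dotProduct, map_eq_zero] at h0
    have h1 := Submodule.finrank_lt_finrank_of_lt hlt
    have h2 := finrank_le_finrank_add_one C (LinearMap.ker (C + Cᵀ).mulVecLin) (quadVertex C)
      (fun x _ y hy ↦ by
        rw [LinearMap.mem_ker, mulVecLin_apply] at hy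
        rw [hy, dotProduct_zero])
      fun x hx hx' ↦ ⟨hx', hx⟩
    omega

end Perfect

section HalfDeterminant

open Matrix Module

variable {ι : Type*} [Fintype ι] [DecidableEq ι]

/-- The trace of `C` times the adjugate of its polarization `C + Cᵀ`; in characteristic two and
odd size this is the half-determinant of the quadratic form `x ↦ xᵀ C x`. -/
def halfDet {A : Type*} [CommRing A] (C : Matrix ι ι A) : A :=
  (C * adjugate (C + Cᵀ)).trace

theorem map_halfDet {A B : Type*} [CommRing A] [CommRing B] (f : A →+* B) (C : Matrix ι ι A) :
    f (halfDet C) = halfDet (C.map f) := by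
  have h : f.mapMatrix (C + Cᵀ) = C.map f + (C.map f)ᵀ := by
    rw [map_add]; rfl
  rw [halfDet, halfDet, AddMonoidHom.map_trace f, ← h, ← RingHom.map_adjugate]
  congr 1
  exact map_mul f.mapMatrix _ _

theorem det_eq_zero_of_odd_card {A : Type*} [CommRing A] [CharP A 2] {M : Matrix ι ι A}
    (hM : M.IsSymm) (hdiag : ∀ i, M i i = 0) (hodd : Odd (Fintype.card ι)) : M.det = 0 := by
  rw [det_apply]
  refine Finset.sum_involution (fun σ _ ↦ σ⁻¹) (fun σ _ ↦ ?_) (fun σ _ hσ hσ' ↦ hσ ?_)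
    (fun σ _ ↦ Finset.mem_univ _) (fun σ _ ↦ inv_inv σ)
  · have : ∏ i, M (σ⁻¹ i) i = ∏ i, M (σ i) i := by
      rw [← Equiv.prod_comp σ]
      exact Finset.prod_congr rfl fun i _ ↦ by simpa using hM.apply (σ i) i
    rw [this, Equiv.Perm.sign_inv]
    exact CharTwo.add_self_eq_zero _
  · obtain ⟨i, hi⟩ := Equiv.Perm.exists_fixed_point_of_prime (p := 2) (n := 1) (σ := σ)
      (fun h ↦ (Nat.not_even_iff_odd.2 hodd) (even_iff_two_dvd.2 h))
      (by rw [pow_one, pow_two]; nth_rw 1 [← hσ']; exact inv_mul_cancel σ)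
    rw [Finset.prod_eq_zero (Finset.mem_univ i) (by rw [hi, hdiag]), smul_zero]

variable {K : Type*} [Field K]

theorem eq_zero_of_adjugate_ne_zero {M : Matrix ι ι K} {p q : ι} (h : adjugate M p q ≠ 0)
    {y : ι → K} (hy : M *ᵥ y = 0) (hyp : y p = 0) : y = 0 := by
  rw [adjugate_apply] at h
  refine eq_zero_of_mulVec_eq_zero h ?_
  rw [updateRow_mulVec, hy, single_one_dotProduct, hyp]
  simp

theorem mulVec_adjugate_col {M : Matrix ι ι K} (h : M.det = 0) (q : ι) :
    M *ᵥ (adjugate M).col q = 0 := by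
  have := congr_arg (fun N : Matrix ι ι K ↦ N.col q) (mul_adjugate M)
  rw [h, zero_smul] at this
  exact this

theorem adjugate_mul_apply_eq {M : Matrix ι ι K} (h : M.det = 0) {y : ι → K} (hy : M *ᵥ y = 0)
    (p q k : ι) : adjugate M p q * y k = y p * adjugate M k q := by
  by_cases hpq : adjugate M p q = 0
  · by_cases hyp : y p = 0
    · rw [hpq, hyp]; simp
    · by_cases hkq : adjugate M k q = 0
      · rw [hpq, hkq]; simp
      · have h0 : y k • (adjugate M).col q - adjugate M k q • y = 0 :=
          eq_zero_of_adjugate_ne_zero hkq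
            (by rw [mulVec_sub, mulVec_smul, mulVec_smul, hy, mulVec_adjugate_col h]; simp)
            (by simp [mul_comm])
        have := congr_fun h0 p
        simp [hpq, hkq, hyp] at this
  · have h0 : adjugate M p q • y - y p • (adjugate M).col q = 0 :=
      eq_zero_of_adjugate_ne_zero hpq
        (by rw [mulVec_sub, mulVec_smul, mulVec_smul, hy, mulVec_adjugate_col h]; simp)
        (by simp [mul_comm])
    have := congr_fun h0 k
    simpa [sub_eq_zero] using this

variable [CharP K 2] [PerfectRing K 2]

theorem exists_adjugate_eq_mul {M : Matrix ι ι K} (hM : M.IsSymm) (h : M.det = 0) :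
    ∃ s : ι → K, M *ᵥ s = 0 ∧ ∀ i j, adjugate M i j = s i * s j := by
  have hsymm (i j : ι) : adjugate M i j = adjugate M j i := by
    conv_lhs => rw [← hM.eq, ← adjugate_transpose]
    rfl
  have hs (i j : ι) : adjugate M i j =
      (frobeniusEquiv K 2).symm (adjugate M i i) * (frobeniusEquiv K 2).symm (adjugate M j j) := by
    apply frobenius_inj K 2
    rw [map_mul, frobenius_apply_frobeniusEquiv_symm, frobenius_apply_frobeniusEquiv_symm,
      frobenius_def, pow_two]
    have := adjugate_mul_apply_eq h (mulVec_adjugate_col h i) i j j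
    simp only [col_apply] at this
    rw [← this, hsymm j i]
  refine ⟨fun i ↦ (frobeniusEquiv K 2).symm (adjugate M i i), ?_, hs⟩
  by_contra hne
  obtain ⟨j, hj⟩ : ∃ j, (frobeniusEquiv K 2).symm (adjugate M j j) ≠ 0 := by
    by_contra! h0
    exact hne (by simp only [h0]; exact mulVec_zero M)
  have hcol : (adjugate M).col j = (frobeniusEquiv K 2).symm (adjugate M j j) •
      fun i ↦ (frobeniusEquiv K 2).symm (adjugate M i i) :=
    funext fun i ↦ (hs i j).trans (mul_comm _ _)
  have := mulVec_adjugate_col h j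
  rw [hcol, mulVec_smul] at this
  exact (smul_ne_zero hj hne) this

theorem halfDet_ne_zero_iff (hodd : Odd (Fintype.card ι)) (C : Matrix ι ι K) :
    halfDet C ≠ 0 ↔ quadVertex C = ⊥ := by
  have hsymm : (C + Cᵀ).IsSymm := by
    rw [IsSymm, transpose_add, transpose_transpose, add_comm]
  have hdet : (C + Cᵀ).det = 0 :=
    det_eq_zero_of_odd_card hsymm (fun i ↦ CharTwo.add_self_eq_zero _) hodd
  obtain ⟨s, hs, hadj⟩ := exists_adjugate_eq_mul hsymm hdet
  have hhalf : halfDet C = s ⬝ᵥ C *ᵥ s := by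
    simp only [halfDet, trace, diag_apply, mul_apply, dotProduct, mulVec, Finset.mul_sum, hadj]
    exact Finset.sum_congr rfl fun i _ ↦ Finset.sum_congr rfl fun j _ ↦ by ring
  rw [hhalf]
  constructor
  · intro h
    obtain ⟨p, hp⟩ : ∃ p, s p ≠ 0 := by
      by_contra! h0
      exact h (by rw [(funext h0 : s = 0), zero_dotProduct])
    refine (Submodule.eq_bot_iff _).2 fun y ⟨hy, hy'⟩ ↦ ?_
    have hys : y = (y p / s p) • s := by
      ext k
      have := adjugate_mul_apply_eq hdet hy' p p k
      rw [hadj, hadj] at this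
      rw [Pi.smul_apply, smul_eq_mul]
      field_simp
      exact mul_left_cancel₀ hp (by linear_combination this)
    rw [hys, quad_smul, mul_eq_zero, or_iff_left h] at hy
    rw [hys, pow_eq_zero_iff two_ne_zero |>.1 hy, zero_smul]
  · intro h h0
    obtain ⟨z, hz, hz'⟩ := exists_mulVec_eq_zero_iff.2 hdet
    obtain ⟨p, hp⟩ := Function.ne_iff.1 hz
    rw [Pi.zero_apply] at hp
    have hker := finrank_le_finrank_add_one C (LinearMap.ker (C + Cᵀ).mulVecLin) ⊥
      (fun x _ y hy ↦ by
        rw [LinearMap.mem_ker, mulVecLin_apply] at hy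
        rw [hy, dotProduct_zero])
      fun x hx hx' ↦ h.le ⟨hx', hx⟩
    rw [finrank_bot, zero_add, finrank_le_one_iff] at hker
    obtain ⟨v, hv⟩ := hker
    have hpp : adjugate (C + Cᵀ) p p ≠ 0 := by
      rw [adjugate_apply]
      intro hd
      obtain ⟨y, hy, hy'⟩ := exists_mulVec_eq_zero_iff.2 hd
      rw [updateRow_mulVec, single_one_dotProduct] at hy'
      have hyp : y p = 0 := by simpa using congr_fun hy' p
      have hyA (i : ι) (hi : i ≠ p) : ((C + Cᵀ) *ᵥ y) i = 0 := by
        simpa [hi] using congr_fun hy' i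
      have hyp' : ((C + Cᵀ) *ᵥ y) p = 0 := by
        have h1 : z ⬝ᵥ (C + Cᵀ) *ᵥ y = 0 := by
          rw [dotProduct_mulVec, ← mulVec_transpose, hsymm.eq, hz', zero_dotProduct]
        rw [dotProduct, Finset.sum_eq_single p (fun i _ hi ↦ by rw [hyA i hi, mul_zero]) (by simp),
          mul_eq_zero, or_iff_right hp] at h1
        exact h1
      have hyk : y ∈ LinearMap.ker (C + Cᵀ).mulVecLin := by
        rw [LinearMap.mem_ker, mulVecLin_apply]
        ext i
        by_cases hi : i = p
        · rw [hi, hyp']; rfl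
        · exact hyA i hi
      obtain ⟨c, hc⟩ := hv ⟨z, hz'⟩
      obtain ⟨d, hd⟩ := hv ⟨y, hyk⟩
      have hc : c • (v : ι → K) = z := congr_arg Subtype.val hc
      have hd : d • (v : ι → K) = y := congr_arg Subtype.val hd
      rw [← hc, Pi.smul_apply, smul_eq_mul] at hp
      rw [← hd, Pi.smul_apply, smul_eq_mul, mul_eq_zero,
        or_iff_left (right_ne_zero_of_mul hp)] at hyp
      exact hy (by rw [← hd, hyp, zero_smul])
    have hsN : s ∈ quadVertex C := ⟨h0, hs⟩
    rw [h, Submodule.mem_bot] at hsN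
    simp [hadj, hsN] at hpp

end HalfDeterminant

section Restriction

open Matrix Module

theorem natDegree_halfDet_le {A : Type*} [CommRing A] {m : ℕ}
    (C D : Matrix (Fin (m + 1)) (Fin (m + 1)) A) :
    (halfDet (C.map Polynomial.C + (Polynomial.X : Polynomial A) • D.map Polynomial.C)).natDegree ≤
      m + 1 := by
  have hpol : C.map Polynomial.C + (Polynomial.X : Polynomial A) • D.map Polynomial.C +
      (C.map Polynomial.C + (Polynomial.X : Polynomial A) • D.map Polynomial.C)ᵀ =
      (Polynomial.X : Polynomial A) • (D + Dᵀ).map Polynomial.C + (C + Cᵀ).map Polynomial.C := by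
    ext i j : 1
    simp
    ring
  rw [halfDet, hpol, trace]
  refine Polynomial.natDegree_sum_le_of_forall_le _ _ fun i _ ↦ ?_
  rw [diag_apply, mul_apply]
  refine Polynomial.natDegree_sum_le_of_forall_le _ _ fun j _ ↦ ?_
  refine (Polynomial.natDegree_mul_le_of_le (m := 1) (n := m) ?_ ?_).trans_eq (add_comm 1 m)
  · simp only [Matrix.add_apply, Matrix.map_apply, Matrix.smul_apply, smul_eq_mul]
    compute_degree
  · rw [adjugate_fin_succ_eq_det_submatrix]
    refine (Polynomial.natDegree_mul_le_of_le (m := 0) ?_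
      ((Polynomial.natDegree_det_X_add_C_le _ _).trans_eq (Fintype.card_fin m))).trans_eq
        (zero_add m)
    compute_degree

variable {K : Type*} [Field K] {ι κ : Type*} [Fintype ι] [Fintype κ]

theorem mem_quadVertex_transpose_mul_mul {E : Matrix ι κ K} {C : Matrix ι ι K} {x : κ → K} :
    x ∈ quadVertex (Eᵀ * C * E) ↔
      (E *ᵥ x) ⬝ᵥ C *ᵥ (E *ᵥ x) = 0 ∧ Eᵀ *ᵥ ((C + Cᵀ) *ᵥ (E *ᵥ x)) = 0 := by
  rw [mem_quadVertex]
  refine and_congr ?_ ?_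
  · rw [← mulVec_mulVec, ← mulVec_mulVec, dotProduct_transpose_mulVec, dotProduct_comm]
  · rw [transpose_mul, transpose_mul, transpose_transpose, ← Matrix.mul_assoc, ← Matrix.add_mul,
      ← Matrix.mul_add, mulVec_mulVec, mulVec_mulVec]

theorem quadVertex_transpose_mul_mul_eq_bot {E : Matrix ι κ K} (hE : Function.Injective E.mulVec)
    {C : Matrix ι ι K} (h : IsCompl (quadVertex C) (LinearMap.range E.mulVecLin)) :
    quadVertex (Eᵀ * C * E) = ⊥ := by
  classical
  refine (Submodule.eq_bot_iff _).2 fun x hx ↦ ?_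
  rw [mem_quadVertex_transpose_mul_mul] at hx
  have hpol (u v : ι → K) : u ⬝ᵥ (C + Cᵀ) *ᵥ v = v ⬝ᵥ (C + Cᵀ) *ᵥ u := by
    conv_lhs => rw [dotProduct_mulVec, ← mulVec_transpose, transpose_add, transpose_transpose,
      add_comm, dotProduct_comm]
  have hEx : E *ᵥ x ∈ quadVertex C := by
    refine ⟨hx.1, dotProduct_eq_zero _ fun y ↦ ?_⟩
    obtain ⟨z, hz, _, ⟨x', rfl⟩, rfl⟩ :=
      Submodule.mem_sup.1 (h.sup_eq_top ▸ Submodule.mem_top (x := y))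
    rw [dotProduct_comm, add_dotProduct, hpol, hz.2, dotProduct_zero, zero_add, mulVecLin_apply,
      dotProduct_comm, ← dotProduct_transpose_mulVec, hx.2, dotProduct_zero]
  have h0 := Submodule.disjoint_def.1 h.disjoint _ hEx ⟨x, rfl⟩
  exact hE (h0.trans (mulVec_zero E).symm)

theorem finrank_quadVertex_add_le {E : Matrix ι κ K} {C : Matrix ι ι K}
    (h : quadVertex (Eᵀ * C * E) = ⊥) (hE : Function.Injective E.mulVec) :
    finrank K (quadVertex C) + Fintype.card κ ≤ Fintype.card ι := by
  have hdisj : Disjoint (quadVertex C) (LinearMap.range E.mulVecLin) := by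
    refine Submodule.disjoint_def.2 ?_
    rintro _ hx ⟨x, rfl⟩
    have hx0 : x ∈ quadVertex (Eᵀ * C * E) :=
      mem_quadVertex_transpose_mul_mul.2 ⟨hx.1, by
        have := hx.2
        rw [mulVecLin_apply] at this
        rw [this, mulVec_zero]⟩
    rw [h, Submodule.mem_bot] at hx0
    rw [hx0, map_zero]
  have := Submodule.finrank_add_finrank_le_of_disjoint hdisj
  rwa [finrank_fintype_fun_eq_card, LinearMap.finrank_range_of_inj hE,
    finrank_fintype_fun_eq_card] at this

theorem exists_finrank_quadVertex_add_smul_le {F L : Type*} [Field F] [Finite F] [Field L]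
    [Algebra F L] [CharP L 2] [PerfectRing L 2] {r : ℕ} (hodd : Odd r) (hr : r < Nat.card F)
    (C D : Matrix ι ι L) (t₀ : L)
    (h : finrank L (quadVertex (C + t₀ • D)) + r = Fintype.card ι) :
    ∃ t : F, finrank L (quadVertex (C + algebraMap F L t • D)) + r ≤ Fintype.card ι := by
  obtain ⟨W, hW⟩ := Submodule.exists_isCompl (quadVertex (C + t₀ • D))
  have hWr : finrank L W = r := by
    have := Submodule.finrank_add_eq_of_isCompl hW
    rw [finrank_fintype_fun_eq_card] at this
    omega
  let b : Basis (Fin r) L W := finBasisOfFinrankEq L W hWr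
  let E : Matrix ι (Fin r) L := (Matrix.of fun i ↦ (b i : ι → L))ᵀ
  have hE : Function.Injective E.mulVec :=
    mulVec_injective_iff.2 (b.linearIndependent.map' W.subtype W.ker_subtype)
  have hEW : LinearMap.range E.mulVecLin = W := by
    rw [range_mulVecLin]
    change Submodule.span L (Set.range (W.subtype ∘ b)) = W
    rw [Set.range_comp, ← Submodule.map_span, b.span_eq, Submodule.map_top, W.range_subtype]
  let P : Polynomial L := halfDet ((Eᵀ * C * E).map Polynomial.C +
    (Polynomial.X : Polynomial L) • (Eᵀ * D * E).map Polynomial.C)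
  have hP (t : L) : P.eval t = halfDet (Eᵀ * (C + t • D) * E) := by
    rw [← Polynomial.coe_evalRingHom, map_halfDet]
    congr 1
    rw [Matrix.mul_add, Matrix.add_mul, Matrix.mul_smul, Matrix.smul_mul]
    ext i j
    simp [-Matrix.map_mul, mul_comm t]
  have hcard : Odd (Fintype.card (Fin r)) := by rwa [Fintype.card_fin]
  have hP0 : P ≠ 0 := by
    intro h0
    refine (halfDet_ne_zero_iff hcard _).2
      (quadVertex_transpose_mul_mul_eq_bot hE (hEW.symm ▸ hW)) ?_
    rw [← hP, h0, Polynomial.eval_zero]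
  obtain ⟨t, ht⟩ : ∃ t : F, P.eval (algebraMap F L t) ≠ 0 := by
    by_contra! h0
    have := Fintype.ofFinite F
    refine hP0 (Polynomial.eq_zero_of_natDegree_lt_card_of_eval_eq_zero P
      (algebraMap F L).injective h0 ?_)
    rw [← Nat.card_eq_fintype_card]
    refine lt_of_le_of_lt ?_ hr
    obtain ⟨m, rfl⟩ : ∃ m, r = m + 1 := ⟨r - 1, by have := hodd.pos; omega⟩
    exact natDegree_halfDet_le _ _
  refine ⟨t, ?_⟩
  rw [hP, halfDet_ne_zero_iff hcard] at ht
  simpa using finrank_quadVertex_add_le ht hE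

end Restriction

section RankPerturbation

open Matrix Module

variable {K : Type*} [Field K] [Infinite K] {ι : Type*} [Fintype ι]

theorem exists_rank_add_card_le {κ : Type*} [Fintype κ] [DecidableEq κ] (B H : Matrix ι ι K)
    (Z : Matrix κ ι K) (hZ : Z * B = 0) (hZ' : B * Zᵀ = 0) (hdet : (Z * H * Zᵀ).det ≠ 0) :
    ∃ t : K, B.rank + Fintype.card κ ≤ (B + t • H).rank := by
  obtain ⟨P, Q, hPQ⟩ := exists_mul_mul_eq_one B
  let p : Polynomial K := (fromBlocks
    (1 + (Polynomial.X : Polynomial K) • (P * H * Q).map Polynomial.C)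
    ((P * H * Zᵀ).map Polynomial.C) ((Polynomial.X : Polynomial K) • (Z * H * Q).map Polynomial.C)
    ((Z * H * Zᵀ).map Polynomial.C)).det
  have hp (t : K) : p.eval t = (fromBlocks (1 + t • (P * H * Q)) (P * H * Zᵀ) (t • (Z * H * Q))
      (Z * H * Zᵀ)).det := by
    rw [← Polynomial.coe_evalRingHom, RingHom.map_det, RingHom.mapMatrix_apply, fromBlocks_map]
    congr 2 <;> ext i j <;> simp [-Matrix.map_mul, mul_comm t, Matrix.one_apply, apply_ite]
  have hp0 : p ≠ 0 := by
    intro h0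
    have := hp 0
    rw [h0, Polynomial.eval_zero, zero_smul, zero_smul, add_zero, det_fromBlocks_zero₂₁, det_one,
      one_mul] at this
    exact hdet this.symm
  obtain ⟨t, ht⟩ : ∃ t : K, (Polynomial.X * p).eval t ≠ 0 := by
    by_contra! h0
    exact mul_ne_zero Polynomial.X_ne_zero hp0 (Polynomial.funext fun t ↦ by simp [h0 t])
  rw [Polynomial.eval_mul, Polynomial.eval_X, hp] at ht
  refine ⟨t, ?_⟩
  have hprod : fromRows P Z * (B + t • H) * fromCols Q Zᵀ =
      fromBlocks (1 + t • (P * H * Q)) (P * H * Zᵀ) (t • (Z * H * Q)) (Z * H * Zᵀ) *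
        fromBlocks 1 0 0 (t • 1) := by
    rw [fromRows_mul, fromRows_mul_fromCols, fromBlocks_multiply]
    simp only [Matrix.mul_add, Matrix.add_mul, Matrix.mul_smul, Matrix.smul_mul, hPQ, hZ,
      Matrix.mul_assoc, hZ']
    simp [← Matrix.mul_assoc]
  have hunit : IsUnit (fromRows P Z * (B + t • H) * fromCols Q Zᵀ) := by
    rw [isUnit_iff_isUnit_det, hprod, det_mul, det_fromBlocks_zero₂₁, isUnit_iff_ne_zero]
    simp [left_ne_zero_of_mul ht, right_ne_zero_of_mul ht]
  calc B.rank + Fintype.card κ = (fromRows P Z * (B + t • H) * fromCols Q Zᵀ).rank := by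
        rw [rank_of_isUnit _ hunit, Fintype.card_sum, Fintype.card_fin]
    _ ≤ (fromRows P Z * (B + t • H)).rank := rank_mul_le_left _ _
    _ ≤ _ := rank_mul_le_right _ _

end RankPerturbation

section Isotropy

open Matrix Module

theorem polar_comm {K ι : Type*} [Field K] [Fintype ι] (C : Matrix ι ι K) (x y : ι → K) :
    x ⬝ᵥ (C + Cᵀ) *ᵥ y = y ⬝ᵥ (C + Cᵀ) *ᵥ x := by
  conv_lhs => rw [dotProduct_mulVec, ← mulVec_transpose, transpose_add, transpose_transpose,
    add_comm, dotProduct_comm]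

theorem polar_self {K ι : Type*} [Field K] [CharP K 2] [Fintype ι] (C : Matrix ι ι K) (x : ι → K) :
    x ⬝ᵥ (C + Cᵀ) *ᵥ x = 0 := by
  rw [add_mulVec, dotProduct_add, dotProduct_transpose_mulVec, dotProduct_comm]
  exact CharTwo.add_self_eq_zero _

theorem polar_eq_zero_of_rank_lt {K ι : Type*} [Field K] [Infinite K] [CharP K 2] [Fintype ι]
    (G H : Matrix ι ι K) {x y : ι → K} (hx : (G + Gᵀ) *ᵥ x = 0) (hy : (G + Gᵀ) *ᵥ y = 0)
    (h : ∀ t : K, (G + Gᵀ + t • (H + Hᵀ)).rank < (G + Gᵀ).rank + 2) :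
    x ⬝ᵥ (H + Hᵀ) *ᵥ y = 0 := by
  by_contra hne
  let Z : Matrix (Fin 2) ι K := Matrix.of ![x, y]
  have hZ' : (G + Gᵀ) * Zᵀ = 0 := by
    ext i j
    fin_cases j
    · exact congr_fun hx i
    · exact congr_fun hy i
  have hZ : Z * (G + Gᵀ) = 0 := by
    have := congr_arg transpose hZ'
    rwa [transpose_mul, transpose_add, transpose_transpose, transpose_transpose, add_comm,
      transpose_zero] at this
  have happ (i j : Fin 2) : (Z * (H + Hᵀ) * Zᵀ) i j = Z i ⬝ᵥ (H + Hᵀ) *ᵥ Z j := by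
    rw [Matrix.mul_assoc]; rfl
  obtain ⟨t, ht⟩ := exists_rank_add_card_le (G + Gᵀ) (H + Hᵀ) Z hZ hZ' (by
    rw [det_fin_two, happ, happ, happ, happ, polar_self, zero_mul, zero_sub, neg_ne_zero,
      polar_comm H (Z 1)]
    exact mul_ne_zero hne hne)
  rw [Fintype.card_fin] at ht
  exact (h t).not_ge ht

theorem polar_eq_zero_of_mem_quadVertex {F L : Type*} [Field F] [CharP F 2] [PerfectRing F 2]
    [Field L] [Infinite L] [CharP L 2] (f : F →+* L) {n r : ℕ} (G H : Matrix (Fin n) (Fin n) F)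
    (hG : finrank F (quadVertex G) + r ≤ n)
    (hr : ∀ t : L, n ≤ finrank L (quadVertex (G.map f + t • H.map f)) + r)
    {x y : Fin n → F} (hx : x ∈ quadVertex G) (hy : y ∈ quadVertex G) :
    x ⬝ᵥ (H + Hᵀ) *ᵥ y = 0 := by
  have hmap (C : Matrix (Fin n) (Fin n) F) : C.map f + (C.map f)ᵀ = (C + Cᵀ).map f := by
    rw [← transpose_map, ← Matrix.map_add f (map_add f)]
  have hmul (C : Matrix (Fin n) (Fin n) F) (x : Fin n → F) : C.map f *ᵥ (f ∘ x) = f ∘ (C *ᵥ x) :=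
    funext fun i ↦ (f.map_mulVec C x i).symm
  have hrank : r ≤ (G.map f + (G.map f)ᵀ).rank + 1 := by
    have h1 := rank_add_finrank_ker (G + Gᵀ)
    have h2 := rank_le_rank_map f (G + Gᵀ)
    have h3 := finrank_le_finrank_add_one G (LinearMap.ker (G + Gᵀ).mulVecLin) (quadVertex G)
      (fun x _ y hy ↦ by
        rw [LinearMap.mem_ker, mulVecLin_apply] at hy
        rw [hy, dotProduct_zero])
      fun x hx hx' ↦ ⟨hx', hx⟩
    rw [Fintype.card_fin] at h1
    rw [hmap]
    omega
  have key : (f ∘ x) ⬝ᵥ (H.map f + (H.map f)ᵀ) *ᵥ (f ∘ y) = 0 := by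
    refine polar_eq_zero_of_rank_lt (G.map f) (H.map f) ?_ ?_ fun t ↦ ?_
    · rw [hmap, hmul, hx.2]; ext; simp
    · rw [hmap, hmul, hy.2]; ext; simp
    · have hle : quadVertex (G.map f + t • H.map f) ≤
          LinearMap.ker (G.map f + (G.map f)ᵀ + t • (H.map f + (H.map f)ᵀ)).mulVecLin := by
        intro z hz
        rw [LinearMap.mem_ker, mulVecLin_apply, ← hz.2, transpose_add, transpose_smul]
        congr 1
        module
      have h1 := Submodule.finrank_mono hle
      have h2 := rank_add_finrank_ker (G.map f + (G.map f)ᵀ + t • (H.map f + (H.map f)ᵀ))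
      have h3 := hr t
      rw [Fintype.card_fin] at h2
      omega
  rwa [hmap, hmul, ← f.map_dotProduct, map_eq_zero] at key

end Isotropy

section Shape

open Matrix Module

variable {K : Type*} [Field K] {n r R : ℕ}

theorem exists_isUnit_det_adapted {N M : Submodule K (Fin n → K)} (hMN : M ≤ N)
    (hN : finrank K N + r = n) (hM : finrank K M + R = n) (hrR : r < R) {v : Fin n → K}
    (hvN : v ∈ N) (hvM : v ∉ M) (φ : (Fin n → K) →ₗ[K] K) (hφ : N ≤ LinearMap.ker φ)
    {α : K} (hα : α = 0 ↔ φ = 0) :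
    ∃ T : Matrix (Fin n) (Fin n) K, IsUnit T.det ∧ (∀ i : Fin n, R ≤ i → T.col i ∈ M) ∧
      (∀ i : Fin n, i + 1 = R → T.col i = v) ∧ (∀ i : Fin n, r ≤ i → T.col i ∈ N) ∧
      (∀ i : Fin n, i + 1 = r → φ (T.col i) = α) ∧ ∀ i : Fin n, i + 1 < r → φ (T.col i) = 0 := by
  obtain ⟨T, hT, h⟩ := exists_isUnit_det_forall_col_mem (fun i : Fin n ↦ {x | (R ≤ i → x ∈ M) ∧
      (i + 1 = R → x = v) ∧ (r ≤ i → x ∈ N) ∧ (i + 1 = r → φ x = α) ∧ (i + 1 < r → φ x = 0)})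
    fun i f hf ↦ by
      have hlt := finrank_span_image_Ioi_lt f i
      have hspan (P : Submodule K (Fin n → K)) (h : ∀ j, i < j → f j ∈ P) :
          Submodule.span K (f '' Set.Ioi i) ≤ P :=
        Submodule.span_le.2 (Set.image_subset_iff.2 h)
      have hex (P : Submodule K (Fin n → K)) (hP : n ≤ finrank K P + i) :
          ∃ w ∈ P, w ∉ Submodule.span K (f '' Set.Ioi i) :=
        SetLike.not_le_iff_exists.1 fun hle ↦ by
          have := Submodule.finrank_mono hle
          omega
      rcases lt_trichotomy ((i : ℕ) + 1) r with hi | hi | hi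
      · obtain ⟨w, hw, hw'⟩ : ∃ w ∈ LinearMap.ker φ, w ∉ Submodule.span K (f '' Set.Ioi i) := by
          by_cases h0 : φ = 0
          · refine hex _ ?_
            rw [h0, LinearMap.ker_zero, finrank_top, finrank_fintype_fun_eq_card, Fintype.card_fin]
            omega
          · refine SetLike.not_le_iff_exists.1 fun hle ↦ ?_
            let j : Fin n := ⟨r - 1, by omega⟩
            have hij : i < j := by rw [Fin.lt_def]; simp only [j]; omega
            have hj : φ (f j) = α := (hf j hij).2.2.2.1 (by simp only [j]; omega)
            have hlt' : LinearMap.ker φ < Submodule.span K (f '' Set.Ioi i) := by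
              refine lt_of_le_not_ge hle fun hge ↦ h0 (hα.1 ?_)
              rw [← hj]
              exact hge (Submodule.subset_span ⟨j, hij, rfl⟩)
            have h1 := Submodule.finrank_lt_finrank_of_lt hlt'
            have h2 := φ.finrank_range_add_finrank_ker
            have h3 := Submodule.finrank_le (LinearMap.range φ)
            rw [finrank_fintype_fun_eq_card, Fintype.card_fin] at h2
            rw [finrank_self] at h3
            omega
        exact ⟨w, ⟨by omega, by omega, by omega, by omega, fun _ ↦ hw⟩, hw'⟩
      · obtain ⟨w, hw, hw'⟩ : ∃ w, φ w = α ∧ w ∉ Submodule.span K (f '' Set.Ioi i) := by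
          by_cases h0 : φ = 0
          · obtain ⟨w, -, hw⟩ := hex ⊤ (by simp)
            exact ⟨w, by rw [h0, hα.2 h0]; rfl, hw⟩
          · obtain ⟨w, rfl⟩ := LinearMap.surjective h0 α
            refine ⟨w, rfl, fun hw ↦ h0 (hα.1 ?_)⟩
            exact (hspan _ fun j hj ↦ hφ ((hf j hj).2.2.1 (by rw [Fin.lt_def] at hj; omega))) hw
        exact ⟨w, ⟨by omega, by omega, by omega, fun _ ↦ hw, by omega⟩, hw'⟩
      · rcases lt_trichotomy ((i : ℕ) + 1) R with hi' | hi' | hi'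
        · obtain ⟨w, hw, hw'⟩ := hex N (by omega)
          exact ⟨w, ⟨by omega, by omega, fun _ ↦ hw, by omega, by omega⟩, hw'⟩
        · refine ⟨v, ⟨by omega, fun _ ↦ rfl, fun _ ↦ hvN, by omega, by omega⟩, fun hv ↦ hvM ?_⟩
          exact (hspan M fun j hj ↦ (hf j hj).1 (by rw [Fin.lt_def] at hj; omega)) hv
        · obtain ⟨w, hw, hw'⟩ := hex M (by omega)
          exact ⟨w, ⟨fun _ ↦ hw, by omega, fun _ ↦ hMN hw, by omega, by omega⟩, hw'⟩
  exact ⟨T, hT, fun i ↦ (h i).1, fun i ↦ (h i).2.1, fun i ↦ (h i).2.2.1, fun i ↦ (h i).2.2.2.1,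
    fun i ↦ (h i).2.2.2.2⟩

theorem exists_substMat_eq {G H : Matrix (Fin n) (Fin n) K}
    (hN : finrank K (quadVertex G) + r = n)
    (hM : finrank K ↥(quadVertex G ⊓ quadVertex H) + R = n) (hrR : r < R) {v : Fin n → K}
    (hvN : v ∈ quadVertex G) (hvM : v ∉ quadVertex G ⊓ quadVertex H)
    (hiso : ∀ x ∈ quadVertex G, v ⬝ᵥ (H + Hᵀ) *ᵥ x = 0) {α : K}
    (hα : α = 0 ↔ (H + Hᵀ) *ᵥ v = 0) {i₀ i₁ : Fin n} (hi₀ : (i₀ : ℕ) + 1 = r)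
    (hi₁ : (i₁ : ℕ) + 1 = R) :
    ∃ T : Matrix (Fin n) (Fin n) K, IsUnit T.det ∧
      DependsOnlyOnFirst r (substMat T (quadPoly G)) ∧
      ∃ q : MvPolynomial (Fin n) K, DependsOnlyOnFirst (R - 1) q ∧
        substMat T (quadPoly H) = q + MvPolynomial.C (v ⬝ᵥ H *ᵥ v) * X i₁ ^ 2 +
          MvPolynomial.C α * (X i₀ * X i₁) := by
  let φ : (Fin n → K) →ₗ[K] K := dotProductBilin K K ((H + Hᵀ) *ᵥ v)
  have hφ (x : Fin n → K) : φ x = v ⬝ᵥ (H + Hᵀ) *ᵥ x := by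
    rw [polar_comm, dotProduct_comm]; rfl
  have hφ0 : φ = 0 ↔ (H + Hᵀ) *ᵥ v = 0 := by
    rw [← dotProduct_eq_zero_iff, LinearMap.ext_iff]
    rfl
  obtain ⟨T, hT, hTM, hTv, hTN, hTα, hT0⟩ := exists_isUnit_det_adapted inf_le_left hN hM hrR hvN hvM
    φ (fun x hx ↦ (hφ x).trans (hiso x hx)) (hα.trans hφ0.symm)
  refine ⟨T, hT, (dependsOnlyOnFirst_substMat hT).2 hTN,
    quadPoly (Tᵀ * H * T + (-(v ⬝ᵥ H *ᵥ v)) • Matrix.single i₁ i₁ 1 +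
      (-α) • Matrix.single i₀ i₁ 1), ?_, ?_⟩
  · have hpolar (i j : Fin n) : (Tᵀ * H * T) i j + (Tᵀ * H * T) j i =
        T.col i ⬝ᵥ (H + Hᵀ) *ᵥ T.col j := by
      rw [transpose_mul_mul_apply, transpose_mul_mul_apply, add_mulVec, dotProduct_add,
        dotProduct_transpose_mulVec]
    rw [dependsOnlyOnFirst_quadPoly]
    intro i hi
    by_cases hiR : (i : ℕ) + 1 = R
    · obtain rfl : i = i₁ := Fin.ext (by omega)
      have h01 : i₀ ≠ i := fun h ↦ by rw [h] at hi₀; omega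
      refine ⟨?_, fun j hj ↦ ?_⟩
      · simp [-transpose_add, transpose_mul_mul_apply, hTv i hiR, h01]
      · have hj' := hpolar i j
        rw [hTv i hiR, ← hφ] at hj'
        have hcol : φ (T.col j) = if j = i₀ then α else 0 := by
          split_ifs with h
          · rw [h, hTα i₀ hi₀]
          · by_cases hjr : r ≤ j
            · rw [hφ, hiso _ (hTN j hjr)]
            · exact hT0 j (by have : (j : ℕ) ≠ i₀ := fun h' ↦ h (Fin.ext h'); omega)
        rw [hcol] at hj'
        have hsum : -α * (if j = i₀ then 1 else 0) + (if j = i₀ then α else 0) = 0 := by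
          split_ifs <;> simp
        simp only [Matrix.add_apply, Matrix.smul_apply, Matrix.single_apply, smul_eq_mul, hj.symm,
          h01, @eq_comm _ i₀ j, and_false, and_true, if_false, mul_zero, add_zero]
        linear_combination hj' + hsum
    · have hc := (hTM i (by omega)).2
      have h1 : i ≠ i₁ := fun h ↦ hiR (h ▸ hi₁)
      have h0 : i ≠ i₀ := fun h ↦ by rw [h] at hi; omega
      refine ⟨?_, fun j hj ↦ ?_⟩
      · simp [transpose_mul_mul_apply, hc.1, h1.symm]
      · have := hpolar j i
        rw [hc.2, dotProduct_zero] at this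
        simp [h1.symm, h0.symm]
        linear_combination this
  · rw [substMat_quadPoly, quadPoly_add, quadPoly_add, quadPoly_smul, quadPoly_smul,
      quadPoly_single, quadPoly_single]
    simp only [map_neg]
    ring

end Shape

section Pencil

open Matrix Module

theorem finrank_quadVertex_le_map {K L : Type*} [Field K] [Field L] (f : K →+* L) {n : ℕ}
    (C : Matrix (Fin n) (Fin n) K) :
    finrank K (quadVertex C) ≤ finrank L (quadVertex (C.map f)) := by
  have hle (K : Type _) [Field K] (N : Submodule K (Fin n → K)) : finrank K N ≤ n := by
    simpa using Submodule.finrank_le N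
  have hsInf := sInf_setOf_exists_isUnit_det_col_mem (quadVertex C)
  obtain ⟨T, hT, hcol⟩ := Nat.sInf_mem (s := {m : ℕ | ∃ T : Matrix (Fin n) (Fin n) K,
    IsUnit T.det ∧ ∀ i : Fin n, m ≤ i → T.col i ∈ quadVertex C})
    ⟨n, 1, by simp, fun i hi ↦ absurd i.2 hi.not_gt⟩
  rw [hsInf] at hcol
  have h := Nat.sInf_le (s := {m : ℕ | ∃ T : Matrix (Fin n) (Fin n) L,
    IsUnit T.det ∧ ∀ i : Fin n, m ≤ i → T.col i ∈ quadVertex (C.map f)})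
    (m := n - finrank K (quadVertex C)) ⟨T.map f, by
      rw [← RingHom.mapMatrix_apply, ← RingHom.map_det]; exact hT.map f, fun i hi ↦ by
      obtain ⟨h1, h2⟩ := hcol i hi
      have hmul (C : Matrix (Fin n) (Fin n) K) (x : Fin n → K) :
          C.map f *ᵥ (f ∘ x) = f ∘ (C *ᵥ x) := funext fun i ↦ (f.map_mulVec C x i).symm
      change f ∘ T.col i ∈ _
      refine ⟨?_, ?_⟩
      · rw [hmul, ← f.map_dotProduct, h1, map_zero]
      · rw [← transpose_map, ← Matrix.map_add f (map_add f), hmul, h2]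
        exact funext fun _ ↦ map_zero f⟩
  rw [sInf_setOf_exists_isUnit_det_col_mem] at h
  have h1 := hle K (quadVertex C)
  have h2 : finrank L (quadVertex (C.map f)) ≤ n := by
    simpa using Submodule.finrank_le (quadVertex (C.map f))
  omega

theorem qRank_smul_add_smul_quadPoly {K : Type*} [Field K] {n : ℕ} (a b : K)
    (C D : Matrix (Fin n) (Fin n) K) :
    qRank (MvPolynomial.C a * quadPoly C + MvPolynomial.C b * quadPoly D) =
      n - finrank K (quadVertex (a • C + b • D)) := by
  rw [← quadPoly_smul, ← quadPoly_smul, ← quadPoly_add, qRank_quadPoly]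

theorem isGreatest_pencilRmax {K : Type*} [Field K] {n : ℕ} (C D : Matrix (Fin n) (Fin n) K) :
    IsGreatest {m | ∃ a b : AlgebraicClosure K, (a ≠ 0 ∨ b ≠ 0) ∧
      m = n - finrank (AlgebraicClosure K)
        (quadVertex (a • C.map (algebraMap K (AlgebraicClosure K)) +
          b • D.map (algebraMap K (AlgebraicClosure K))))}
      (pencilRmax (quadPoly C) (quadPoly D)) := by
  simp only [pencilRmax, map_quadPoly, qRank_smul_add_smul_quadPoly]
  have hb : BddAbove {m | ∃ a b : AlgebraicClosure K, (a ≠ 0 ∨ b ≠ 0) ∧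
      m = n - finrank (AlgebraicClosure K)
        (quadVertex (a • C.map (algebraMap K (AlgebraicClosure K)) +
          b • D.map (algebraMap K (AlgebraicClosure K))))} := by
    refine ⟨n, ?_⟩
    rintro m ⟨a, b, -, rfl⟩
    exact Nat.sub_le _ _
  exact ⟨Nat.sSup_mem ⟨_, 1, 0, by simp, rfl⟩ hb, fun m hm ↦ le_csSup hb hm⟩

/-- Over a finite field with at least as many elements as the number of variables, an odd maximal
rank of a pencil over an extension field is attained by a form defined over the field. -/
theorem exists_qRank_eq_of_isGreatest {F L : Type*} [Field F] [Finite F] [CharP F 2] [Field L]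
    [Algebra F L] [CharP L 2] [PerfectRing L 2] {n r : ℕ} (C D : Matrix (Fin n) (Fin n) F)
    (hmax : IsGreatest {m | ∃ a b : L, (a ≠ 0 ∨ b ≠ 0) ∧
      m = n - finrank L (quadVertex (a • C.map (algebraMap F L) + b • D.map (algebraMap F L)))} r)
    (hodd : Odd r) (hlt : r < Nat.card F) :
    ∃ a b : F, qRank (MvPolynomial.C a * quadPoly C + MvPolynomial.C b * quadPoly D) =
      r ∧ ∃ c d : F, a * d - b * c ≠ 0 := by
  have hle (C : Matrix (Fin n) (Fin n) L) : finrank L (quadVertex C) ≤ n := by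
    simpa using Submodule.finrank_le (quadVertex C)
  have hdescend (a b : F) (hab : a ≠ 0 ∨ b ≠ 0)
      (h : finrank L (quadVertex (algebraMap F L a • C.map (algebraMap F L) +
        algebraMap F L b • D.map (algebraMap F L))) + r ≤ n) :
      qRank (MvPolynomial.C a * quadPoly C + MvPolynomial.C b * quadPoly D) = r := by
    have h1 := hmax.2 ⟨algebraMap F L a, algebraMap F L b, by simpa using hab, rfl⟩
    have hmap : algebraMap F L a • C.map (algebraMap F L) + algebraMap F L b •
        D.map (algebraMap F L) = (a • C + b • D).map (algebraMap F L) := by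
      ext
      simp only [Matrix.add_apply, Matrix.smul_apply, Matrix.map_apply, smul_eq_mul, map_add,
        map_mul]
    rw [hmap] at h h1
    have h2 := finrank_quadVertex_map_le (algebraMap F L) (a • C + b • D)
    have h3 := finrank_quadVertex_le_map (algebraMap F L) (a • C + b • D)
    rw [qRank_smul_add_smul_quadPoly]
    omega
  obtain ⟨a, b, hab, hr⟩ := hmax.1
  have hr' := hle (a • C.map (algebraMap F L) + b • D.map (algebraMap F L))
  by_cases ha : a = 0
  · have hb : b ≠ 0 := by tauto
    obtain ⟨t, ht⟩ := exists_finrank_quadVertex_add_smul_le hodd hlt (D.map (algebraMap F L))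
      (C.map (algebraMap F L)) 0 (by
        rw [ha, zero_smul, zero_add, quadVertex_smul _ hb] at hr hr'
        rw [zero_smul, add_zero, Fintype.card_fin]
        omega)
    rw [Fintype.card_fin] at ht
    refine ⟨t, 1, hdescend _ _ (by simp) ?_, 1, 0, by simp⟩
    rwa [map_one, one_smul, add_comm (_ • _)]
  · obtain ⟨t, ht⟩ := exists_finrank_quadVertex_add_smul_le hodd hlt (C.map (algebraMap F L))
      (D.map (algebraMap F L)) (a⁻¹ * b) (by
        rw [← quadVertex_smul _ (inv_ne_zero ha), smul_add, smul_smul, smul_smul,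
          inv_mul_cancel₀ ha, one_smul] at hr hr'
        rw [Fintype.card_fin]
        omega)
    rw [Fintype.card_fin] at ht
    refine ⟨1, t, hdescend _ _ (by simp) ?_, 0, 1, by simp⟩
    rwa [map_one, one_smul]

/-- The polar form of any member of a pencil vanishes on the vertex of a member of maximal rank. -/
theorem polar_eq_zero_of_mem_upperBounds {F L : Type*} [Field F] [CharP F 2] [PerfectRing F 2]
    [Field L] [Algebra F L] [Infinite L] [CharP L 2] {n r : ℕ} (C D : Matrix (Fin n) (Fin n) F)
    (hmax : r ∈ upperBounds {m | ∃ a b : L, (a ≠ 0 ∨ b ≠ 0) ∧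
      m = n - finrank L (quadVertex (a • C.map (algebraMap F L) + b • D.map (algebraMap F L)))})
    {a b c d : F}
    (hdet : a * d - b * c ≠ 0) (h : finrank F (quadVertex (a • C + b • D)) + r ≤ n)
    {x y : Fin n → F} (hx : x ∈ quadVertex (a • C + b • D))
    (hy : y ∈ quadVertex (a • C + b • D)) :
    x ⬝ᵥ ((c • C + d • D) + (c • C + d • D)ᵀ) *ᵥ y = 0 := by
  refine polar_eq_zero_of_mem_quadVertex (algebraMap F L) _ _ h (fun t ↦ ?_) hx hy
  have hmap : (a • C + b • D).map (algebraMap F L) + t • (c • C + d • D).map (algebraMap F L) =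
      (algebraMap F L a + t * algebraMap F L c) • C.map (algebraMap F L) +
      (algebraMap F L b + t * algebraMap F L d) • D.map (algebraMap F L) := by
    ext
    simp only [Matrix.add_apply, Matrix.smul_apply, Matrix.map_apply, smul_eq_mul, map_add, map_mul]
    ring
  have h1 := hmax ⟨algebraMap F L a + t * algebraMap F L c,
    algebraMap F L b + t * algebraMap F L d, by
      by_contra! h0
      apply hdet
      apply (algebraMap F L).injective
      rw [map_sub, map_mul, map_mul, map_zero]
      linear_combination algebraMap F L d * h0.1 - algebraMap F L c * h0.2, rfl⟩
  rw [← hmap] at h1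
  omega

/-- Simultaneous normal forms of two quadratic forms `G`, `H` such that the polar form of `H`
vanishes on the vertex of `G`. -/
theorem exists_normalForm {F : Type*} [Field F] [CharP F 2] [PerfectRing F 2] {n r R : ℕ}
    (G H : Matrix (Fin n) (Fin n) F) (hN : finrank F (quadVertex G) + r = n)
    (hM : finrank F ↥(quadVertex G ⊓ quadVertex H) + R = n) (hr : 0 < r) (hrR : r < R)
    (hiso : ∀ x ∈ quadVertex G, ∀ y ∈ quadVertex G, x ⬝ᵥ (H + Hᵀ) *ᵥ y = 0) :
    (∃ T : Matrix (Fin n) (Fin n) F, IsUnit T.det ∧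
      DependsOnlyOnFirst r (substMat T (quadPoly G)) ∧
      ∃ (q : MvPolynomial (Fin n) F) (h₁ : r - 1 < n) (h₂ : R - 1 < n),
        DependsOnlyOnFirst (R - 1) q ∧
        substMat T (quadPoly H) = q + X (⟨r - 1, h₁⟩ : Fin n) * X (⟨R - 1, h₂⟩ : Fin n)) ∨
    (R = r + 1 ∧ ∃ T : Matrix (Fin n) (Fin n) F, IsUnit T.det ∧
      DependsOnlyOnFirst r (substMat T (quadPoly G)) ∧
      ∃ (q : MvPolynomial (Fin n) F) (h₀ : r - 1 < n) (h₁ : r < n), DependsOnlyOnFirst r q ∧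
        (substMat T (quadPoly H) = q + X (⟨r, h₁⟩ : Fin n) ^ 2 ∨
          substMat T (quadPoly H) = q + X (⟨r, h₁⟩ : Fin n) ^ 2 +
            X (⟨r - 1, h₀⟩ : Fin n) * X (⟨r, h₁⟩ : Fin n))) := by
  classical
  have h₁ : r - 1 < n := by omega
  have h₂ : R - 1 < n := by omega
  by_cases hv : ∃ v ∈ quadVertex G, v ∉ quadVertex G ⊓ quadVertex H ∧ v ⬝ᵥ H *ᵥ v = 0
  · obtain ⟨v, hvN, hvM, hv0⟩ := hv
    obtain ⟨T, hT, hTG, q, hq, hTH⟩ := exists_substMat_eq hN hM hrR hvN hvM (hiso v hvN)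
      (α := 1) (iff_of_false one_ne_zero fun h ↦ hvM ⟨hvN, hv0, h⟩) (i₀ := ⟨r - 1, h₁⟩)
      (i₁ := ⟨R - 1, h₂⟩) (Nat.sub_add_cancel hr) (Nat.sub_add_cancel (by omega))
    exact .inl ⟨T, hT, hTG, q, h₁, h₂, hq, by simpa [hv0] using hTH⟩
  · have hle := finrank_le_finrank_add_one H (quadVertex G) (quadVertex G ⊓ quadVertex H) hiso
      fun x hx hx0 ↦ by
        by_contra hxM
        exact hv ⟨x, hx, hxM, hx0⟩
    obtain rfl : R = r + 1 := by omega
    obtain ⟨v, hvN, hvM⟩ : ∃ v ∈ quadVertex G, v ∉ quadVertex G ⊓ quadVertex H := by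
      by_contra! h
      have := Submodule.finrank_mono (R := F) (s := quadVertex G) (t := quadVertex G ⊓ quadVertex H)
        h
      omega
    obtain ⟨s, hs⟩ : ∃ s : F, s ^ 2 = v ⬝ᵥ H *ᵥ v := ⟨(frobeniusEquiv F 2).symm _,
      frobeniusEquiv_symm_pow_p F 2 _⟩
    have hs0 : s ≠ 0 := by
      rintro rfl
      exact hv ⟨v, hvN, hvM, by simp [← hs]⟩
    have hs1 : (s⁻¹ • v) ⬝ᵥ H *ᵥ (s⁻¹ • v) = 1 := by
      rw [quad_smul, ← hs, ← mul_pow, inv_mul_cancel₀ hs0, one_pow]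
    have hsN := (quadVertex G).smul_mem s⁻¹ hvN
    have hsM : s⁻¹ • v ∉ quadVertex G ⊓ quadVertex H :=
      fun h ↦ hvM (((quadVertex G ⊓ quadVertex H).smul_mem_iff (inv_ne_zero hs0)).1 h)
    obtain ⟨T, hT, hTG, q, hq, hTH⟩ := exists_substMat_eq hN hM hrR hsN hsM (hiso _ hsN)
      (α := if (H + Hᵀ) *ᵥ (s⁻¹ • v) = 0 then 0 else 1) (by simp) (i₀ := ⟨r - 1, h₁⟩)
      (i₁ := ⟨r, h₂⟩) (Nat.sub_add_cancel hr) rfl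
    refine .inr ⟨rfl, T, hT, hTG, q, h₁, h₂, hq, ?_⟩
    rw [hs1] at hTH
    split_ifs at hTH
    · exact .inl (by simpa using hTH)
    · exact .inr (by simpa using hTH)

end Pencil

/-- Lemma `lemshape2`: let `F` be the residue field of the completion of a
number field at a non-archimedean place, of characteristic 2, and `P = <p₁,p₂>` a pencil of
quadratic forms in `n` variables over `F` with `#F ≥ n`; write `r = r(P)`, `R = R(P)` and
suppose `r < R` with `r` odd.  Then a basis `q₁, q₂` of `P` can be chosen with `rank q₁ = r`, and
for any such basis an invertible change of variables over `F` puts `q₁` in the shape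
`q₁'(X_1,…,X_r)` and `q₂` in one of the shapes `q₂'(X_1,…,X_{R-1}) + X_rX_R`, or
`q₂'(X_1,…,X_r) + X_{r+1}²`, or `q₂'(X_1,…,X_r) + X_{r+1}² + X_rX_{r+1}`; when `r ≤ R - 2` the
first shape can always be achieved. -/
theorem stmt_11 {F : Type*} [Field F] {n : ℕ}
    (k : Type*) [Field k] [NumberField k] (v : HeightOneSpectrum (𝓞 k))
    (hres : Nonempty (F ≃+* IsLocalRing.ResidueField (v.adicCompletionIntegers k)))
    (hchar : ringChar F = 2)
    (hcardF : (n : Cardinal) ≤ Cardinal.mk F)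
    (p₁ p₂ : MvPolynomial (Fin n) F)
    (hp₁ : p₁.IsHomogeneous 2) (hp₂ : p₂.IsHomogeneous 2)
    (hindep : LinearIndependent F ![p₁, p₂])
    (r R : ℕ) (hrdef : r = pencilRmax p₁ p₂) (hRdef : R = pencilR p₁ p₂)
    (hrR : r < R) (hodd : Odd r) :
    (∃ a b : F, qRank (MvPolynomial.C a * p₁ + MvPolynomial.C b * p₂) = r ∧
      ∃ c d : F, a * d - b * c ≠ 0) ∧
    (∀ a b c d : F, a * d - b * c ≠ 0 →
      qRank (MvPolynomial.C a * p₁ + MvPolynomial.C b * p₂) = r →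
      (∃ T : Matrix (Fin n) (Fin n) F, IsUnit T.det ∧
        DependsOnlyOnFirst r (substMat T (MvPolynomial.C a * p₁ + MvPolynomial.C b * p₂)) ∧
        ((∃ (q₂' : MvPolynomial (Fin n) F) (h₁ : r - 1 < n) (h₂ : R - 1 < n),
            DependsOnlyOnFirst (R - 1) q₂' ∧
            substMat T (MvPolynomial.C c * p₁ + MvPolynomial.C d * p₂) =
              q₂' + MvPolynomial.X (⟨r - 1, h₁⟩ : Fin n) * MvPolynomial.X (⟨R - 1, h₂⟩ : Fin n)) ∨
         (∃ (q₂' : MvPolynomial (Fin n) F) (h₁ : r < n),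
            DependsOnlyOnFirst r q₂' ∧
            substMat T (MvPolynomial.C c * p₁ + MvPolynomial.C d * p₂) =
              q₂' + MvPolynomial.X (⟨r, h₁⟩ : Fin n) ^ 2) ∨
         (∃ (q₂' : MvPolynomial (Fin n) F) (h₀ : r - 1 < n) (h₁ : r < n),
            DependsOnlyOnFirst r q₂' ∧
            substMat T (MvPolynomial.C c * p₁ + MvPolynomial.C d * p₂) =
              q₂' + MvPolynomial.X (⟨r, h₁⟩ : Fin n) ^ 2 +
                MvPolynomial.X (⟨r - 1, h₀⟩ : Fin n) * MvPolynomial.X (⟨r, h₁⟩ : Fin n)))) ∧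
      (r + 2 ≤ R →
        ∃ T : Matrix (Fin n) (Fin n) F, IsUnit T.det ∧
          DependsOnlyOnFirst r (substMat T (MvPolynomial.C a * p₁ + MvPolynomial.C b * p₂)) ∧
          ∃ (q₂' : MvPolynomial (Fin n) F) (h₁ : r - 1 < n) (h₂ : R - 1 < n),
            DependsOnlyOnFirst (R - 1) q₂' ∧
            substMat T (MvPolynomial.C c * p₁ + MvPolynomial.C d * p₂) =
              q₂' + MvPolynomial.X (⟨r - 1, h₁⟩ : Fin n) *
                MvPolynomial.X (⟨R - 1, h₂⟩ : Fin n))) := by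
  have : Finite F := by
    have := finite_residueField_adicCompletionIntegers k v
    exact Finite.of_equiv _ hres.some.symm.toEquiv
  have : CharP F 2 := ringChar.of_eq hchar
  have : CharP (AlgebraicClosure F) 2 :=
    charP_of_injective_algebraMap (algebraMap F (AlgebraicClosure F)).injective 2
  have : PerfectRing F 2 := PerfectRing.ofFiniteOfIsReduced 2 F
  obtain ⟨C₁, rfl⟩ := exists_eq_quadPoly hp₁
  obtain ⟨C₂, rfl⟩ := exists_eq_quadPoly hp₂
  have hmax := isGreatest_pencilRmax C₁ C₂
  rw [← hrdef] at hmax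
  have hcard : n ≤ Nat.card F := by
    rw [← Nat.cast_card] at hcardF
    exact_mod_cast hcardF
  have hle (N : Submodule F (Fin n → F)) : Module.finrank F N ≤ n := by
    simpa using Submodule.finrank_le N
  have hR := pencilR_quadPoly C₁ C₂
  have hM := hle (quadVertex C₁ ⊓ quadVertex C₂)
  refine ⟨exists_qRank_eq_of_isGreatest C₁ C₂ hmax hodd (by omega), ?_⟩
  intro a b c d hdet hrank
  have hN := hle (quadVertex (a • C₁ + b • C₂))
  rw [qRank_smul_add_smul_quadPoly] at hrank
  have hnf := exists_normalForm (r := r) (R := R) (a • C₁ + b • C₂) (c • C₁ + d • C₂) (by omega)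
    (by rw [quadVertex_inf_quadVertex_eq _ _ hdet]; omega) hodd.pos hrR fun x hx y hy ↦
      polar_eq_zero_of_mem_upperBounds C₁ C₂ hmax.2 hdet (by omega) hx hy
  simp only [quadPoly_add, quadPoly_smul] at hnf
  obtain h | ⟨hRr, T, hT, hG, q, h₀, h₁, hq, hH⟩ := hnf
  · obtain ⟨T, hT, hG, hH⟩ := h
    exact ⟨⟨T, hT, hG, .inl hH⟩, fun _ ↦ ⟨T, hT, hG, hH⟩⟩
  · refine ⟨⟨T, hT, hG, .inr ?_⟩, fun _ ↦ by omega⟩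
    exact hH.imp (fun hH ↦ ⟨q, h₁, hq, hH⟩) fun hH ↦ ⟨q, h₀, h₁, hq, hH⟩
end
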